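/- arXiv:1603.01458 — 2 statements merged into one kernel-verified Lean document; each statement's English description precedes it below -/
import Mathlib

section
/- Let F be a finite group with at least two elements, let G = ℤ ≀ F be the wreath product, let μ be the standard simple switch-walk-switch measure on G, and let S be the standard generating set of G. For every ε > 0 there exists c > 0 such that for all sufficiently large n there is a subset V_n ⊆ G with μ^{*n}(V_n) ≥ 1 − ε and, for every h ∈ V_n and every g ∈ G with l_S(g) ≤ c·√n, (1 − ε)·μ^{*n}(h) ≤ μ^{*n}(h·g) ≤ (1 + ε)·μ^{*n}(h). -/
noncomputable section
open Filter
open scoped Classical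

/-- Convolution of two measures (as real-valued functions) on a group:
`(μ * ν)(g) = Σ_h μ(h) ν(h⁻¹ g)`. -/
def conv {G : Type*} [Group G] (μ ν : G → ℝ) : G → ℝ :=
  fun g => ∑' h : G, μ h * ν (h⁻¹ * g)

/-- `n`-fold convolution power; `convPow μ 0` is the point mass at the identity. -/
def convPow {G : Type*} [Group G] (μ : G → ℝ) : ℕ → G → ℝ
  | 0 => fun g => if g = 1 then 1 else 0
  | n + 1 => conv μ (convPow μ n)

/-- Measure of a subset: `μ(A) = Σ_{x ∈ A} μ(x)`. -/
def measOf {G : Type*} (μ : G → ℝ) (A : Set G) : ℝ := ∑' x : A, μ x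

/-- Word length of `g` with respect to `S ∪ S⁻¹`: the least `k` such that `g` is a
product of `k` elements of `S ∪ S⁻¹`. -/
def wordLength {G : Type*} [Group G] (S : Set G) (g : G) : ℕ :=
  sInf {k | ∃ l : List G, l.length = k ∧ (∀ x ∈ l, x ∈ S ∨ x⁻¹ ∈ S) ∧ l.prod = g}

/-- The group of finitely supported functions `A → F` (pointwise multiplication), as a
subgroup of the product group. -/
def FinMulSupp (A : Type*) (F : Type*) [Group F] : Subgroup (A → F) where
  carrier := {f | (Function.mulSupport f).Finite}
  one_mem' := by simp [Function.mulSupport_one]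
  mul_mem' := by
    intro f g hf hg
    exact (hf.union hg).subset (Function.mulSupport_mul f g)
  inv_mem' := by
    intro f hf
    simpa [Function.mulSupport_inv] using hf

/-- The shift automorphism of `FinMulSupp A F` associated to `z : A`:
`(z · f)(x) = f(x - z)`. -/
def shiftEquiv {A : Type*} [AddCommGroup A] {F : Type*} [Group F] (z : A) :
    FinMulSupp A F ≃* FinMulSupp A F where
  toFun f := ⟨fun x => f.1 (x - z), by
    refine (f.2.image (fun y => y + z)).subset ?_
    intro x hx
    exact ⟨x - z, hx, by simp⟩⟩
  invFun f := ⟨fun x => f.1 (x + z), by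
    refine (f.2.image (fun y => y - z)).subset ?_
    intro x hx
    exact ⟨x + z, hx, by simp⟩⟩
  left_inv f := by
    apply Subtype.ext
    funext x
    simp
  right_inv f := by
    apply Subtype.ext
    funext x
    simp
  map_mul' f g := rfl

/-- The shift action of `A` on `FinMulSupp A F`, as a homomorphism
`Multiplicative A →* MulAut (FinMulSupp A F)`. -/
def shiftHom (A : Type*) [AddCommGroup A] (F : Type*) [Group F] :
    Multiplicative A →* MulAut (FinMulSupp A F) where
  toFun z := shiftEquiv (Multiplicative.toAdd z)
  map_one' := by
    apply MulEquiv.ext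
    intro f
    apply Subtype.ext
    funext x
    simp [shiftEquiv]
  map_mul' z w := by
    apply MulEquiv.ext
    intro f
    apply Subtype.ext
    funext x
    simp [shiftEquiv, MulAut.mul_apply, sub_sub]

/-- The wreath product `A ≀ F` (with acting group `A`): the semidirect product of the group
of finitely supported functions `A → F` with `A` acting by shifts. -/
abbrev Wreath (A : Type*) [AddCommGroup A] (F : Type*) [Group F] : Type _ :=
  FinMulSupp A F ⋊[shiftHom A F] Multiplicative A

/-- The function supported at `0 : A` with value `f` there. -/
def deltaF {A : Type*} [AddCommGroup A] {F : Type*} [Group F] (f : F) : FinMulSupp A F :=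
  ⟨fun x => if x = 0 then f else 1, by
    refine (Set.finite_singleton (0 : A)).subset ?_
    intro x hx
    by_contra hx0
    simp only [Function.mem_mulSupport] at hx
    simp only [Set.mem_singleton_iff] at hx0
    simp [hx0] at hx⟩

/-- The measure on the wreath product carried by the `A`-factor, induced by `ν : A → ℝ`. -/
def liftA {A : Type*} [AddCommGroup A] {F : Type*} [Group F] (ν : A → ℝ) :
    Wreath A F → ℝ :=
  fun g => if g.left = 1 then ν (Multiplicative.toAdd g.right) else 0

/-- The uniform measure on the copy of `F` at coordinate `0 : A`. -/
def unifF (A : Type*) [AddCommGroup A] (F : Type*) [Group F] [Fintype F] :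
    Wreath A F → ℝ :=
  Set.indicator {g : Wreath A F | ∃ f : F, g = SemidirectProduct.inl (deltaF f)}
    (fun _ => (Fintype.card F : ℝ)⁻¹)

/-- The switch-walk-switch measure `μ = μ_B * μ_A * μ_B` on the wreath product, where
`μ_A` is the lift of `ν` to the `A`-factor and `μ_B` is uniform on the copy of `F` at
coordinate `0`. -/
def swsMeasure {A : Type*} [AddCommGroup A] {F : Type*} [Group F] [Fintype F]
    (ν : A → ℝ) : Wreath A F → ℝ :=
  conv (unifF A F) (conv (liftA ν) (unifF A F))

/-- The standard generating set of `ℤ ≀ F`: the elements `(±1, e)` together with the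
elements `(0, f·δ₀)` for `f ∈ F`. -/
def stdGenZ (F : Type*) [Group F] : Set (Wreath ℤ F) :=
  {g | g = SemidirectProduct.inr (Multiplicative.ofAdd (1 : ℤ)) ∨
       g = SemidirectProduct.inr (Multiplicative.ofAdd (-1 : ℤ))} ∪
  {g | ∃ f : F, g = SemidirectProduct.inl (deltaF f)}

/-- free walk distribution -/
def pw (r t : ℝ) : ℕ → ℤ → ℝ
  | 0 => fun z => if z = 0 then 1 else 0
  | n + 1 => fun z => r * pw r t n z + t * (pw r t n (z - 1) + pw r t n (z + 1))

theorem pw_succ (r t : ℝ) (n : ℕ) (z : ℤ) :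
    pw r t (n + 1) z = r * pw r t n z + t * (pw r t n (z - 1) + pw r t n (z + 1)) := rfl

theorem pw_nonneg {r t : ℝ} (hr : 0 < r) (ht : 0 < t) (n : ℕ) (z : ℤ) : 0 ≤ pw r t n z := by
  induction n generalizing z with
  | zero => simp only [pw]; split_ifs <;> norm_num
  | succ n ih =>
    rw [pw_succ]
    have := ih z; have := ih (z - 1); have := ih (z + 1)
    positivity

theorem pw_zero_of_gt (r t : ℝ) (n : ℕ) (z : ℤ) (h : (n : ℤ) < |z|) : pw r t n z = 0 := by
  induction n generalizing z with
  | zero =>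
    simp only [pw]; rw [if_neg]; rintro rfl; simp at h
  | succ n ih =>
    rw [pw_succ, ih z, ih (z - 1), ih (z + 1)]
    · simp
    all_goals (push_cast at h; grind)

theorem pw_le_one {r t : ℝ} (hr : 0 < r) (ht : 0 < t) (hrt : r + 2 * t = 1) (n : ℕ) (z : ℤ) :
    pw r t n z ≤ 1 := by
  induction n generalizing z with
  | zero => simp only [pw]; split_ifs <;> norm_num
  | succ n ih =>
    rw [pw_succ]
    have := ih z; have := ih (z - 1); have := ih (z + 1)
    nlinarith

theorem pw_neg (r t : ℝ) (n : ℕ) (z : ℤ) : pw r t n (-z) = pw r t n z := by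
  induction n generalizing z with
  | zero => simp [pw]
  | succ n ih =>
    rw [pw_succ, pw_succ, ih z, ← ih (z - 1), ← ih (z + 1)]
    rw [show -(z - 1) = -z + 1 by ring, show -(z + 1) = -z - 1 by ring]; ring

theorem pw_mul_z (r t : ℝ) (n : ℕ) (z : ℤ) :
    (z : ℝ) * pw r t (n + 1) z = (n + 1) * t * (pw r t n (z - 1) - pw r t n (z + 1)) := by
  induction n generalizing z with
  | zero =>
    rw [pw_succ]; simp only [pw]
    by_cases h0 : z = 0
    · subst h0; simp
    by_cases h1 : z = 1
    · subst h1; simp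
    by_cases h2 : z = -1
    · subst h2; simp
    have : z - 1 ≠ 0 := by omega
    have : z + 1 ≠ 0 := by omega
    simp [*]
  | succ n ih =>
    rw [pw_succ r t (n + 1) z]
    have e0 := ih z
    have e1 := ih (z - 1)
    have e2 := ih (z + 1)
    have s1 := pw_succ r t n (z - 1)
    have s2 := pw_succ r t n (z + 1)
    rw [show z - 1 + 1 = z by ring] at e1 s1
    rw [show z + 1 - 1 = z by ring] at e2 s2
    push_cast at *
    linear_combination r * e0 + t * e1 + t * e2 - (n + 1) * t * s1 + (n + 1) * t * s2

theorem pw_supp_finite (r t : ℝ) (n : ℕ) : (Function.support (pw r t n)).Finite := by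
  apply (Set.finite_Icc (-(n : ℤ)) n).subset
  intro z hz
  by_contra h
  apply hz
  apply pw_zero_of_gt
  simp only [Set.mem_Icc] at h
  grind

theorem pw_summable (r t : ℝ) (n : ℕ) (f : ℤ → ℝ) : Summable (fun z => pw r t n z * f z) := by
  apply summable_of_hasFiniteSupport
  apply (pw_supp_finite r t n).subset
  intro z hz h
  apply hz
  simp [h]

/-- free walk expectation -/
def fE (r t : ℝ) (n : ℕ) (f : ℤ → ℝ) : ℝ := ∑' z, pw r t n z * f z

theorem fE_zero (r t : ℝ) (f : ℤ → ℝ) : fE r t 0 f = f 0 := by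
  unfold fE
  rw [tsum_eq_single 0]
  · simp [pw]
  · intro z hz; simp [pw, hz]

theorem fE_smul (r t : ℝ) (n : ℕ) (c : ℝ) (f : ℤ → ℝ) :
    fE r t n (fun z => c * f z) = c * fE r t n f := by
  unfold fE
  rw [← tsum_mul_left]
  congr 1; ext z; ring

theorem fE_mono {r t : ℝ} (hr : 0 < r) (ht : 0 < t) (n : ℕ) {f g : ℤ → ℝ} (h : ∀ z, f z ≤ g z) :
    fE r t n f ≤ fE r t n g := by
  apply Summable.tsum_le_tsum _ (pw_summable _ _ _ _) (pw_summable _ _ _ _)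
  intro z
  exact mul_le_mul_of_nonneg_left (h z) (pw_nonneg hr ht n z)

theorem fE_succ (r t : ℝ) (n : ℕ) (f : ℤ → ℝ) :
    fE r t (n + 1) f = fE r t n (fun z => r * f z + t * (f (z - 1) + f (z + 1))) := by
  have e1 : ∑' z, pw r t n (z - 1) * f z = ∑' z, pw r t n z * f (z + 1) := by
    rw [← (Equiv.addRight (1 : ℤ)).tsum_eq]; simp
  have e2 : ∑' z, pw r t n (z + 1) * f z = ∑' z, pw r t n z * f (z - 1) := by
    rw [← (Equiv.subRight (1 : ℤ)).tsum_eq]; simp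
  have s1 : Summable (fun z => pw r t n (z - 1) * f z) := by
    rw [← (Equiv.addRight (1 : ℤ)).summable_iff]
    simpa [Function.comp_def] using pw_summable r t n (fun z => f (z + 1))
  have s2 : Summable (fun z => pw r t n (z + 1) * f z) := by
    rw [← (Equiv.subRight (1 : ℤ)).summable_iff]
    simpa [Function.comp_def] using pw_summable r t n (fun z => f (z - 1))
  unfold fE
  have l : ∀ z, pw r t (n + 1) z * f z = r * (pw r t n z * f z) +
      t * (pw r t n (z - 1) * f z) + t * (pw r t n (z + 1) * f z) := by
    intro z; rw [pw_succ]; ring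
  have l' : ∀ z, pw r t n z * (r * f z + t * (f (z - 1) + f (z + 1))) = r * (pw r t n z * f z) +
      t * (pw r t n z * f (z + 1)) + t * (pw r t n z * f (z - 1)) := by
    intro z; ring
  have s0 := pw_summable r t n f
  have s3 := pw_summable r t n (fun z => f (z + 1))
  have s4 := pw_summable r t n (fun z => f (z - 1))
  simp_rw [l, l']
  rw [Summable.tsum_add ((s0.mul_left r).add (s1.mul_left t)) (s2.mul_left t),
    Summable.tsum_add (s0.mul_left r) (s1.mul_left t),
    Summable.tsum_add ((s0.mul_left r).add (s3.mul_left t)) (s4.mul_left t),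
    Summable.tsum_add (s0.mul_left r) (s3.mul_left t)]
  simp only [tsum_mul_left, e1, e2]

theorem fE_cosh {r t : ℝ} (n : ℕ) (c : ℝ) :
    fE r t n (fun z => Real.cosh (c * z)) = (r + 2 * t * Real.cosh c) ^ n := by
  induction n with
  | zero => simp [fE_zero]
  | succ n ih =>
    rw [fE_succ, pow_succ', ← ih, ← fE_smul]
    congr 1; ext z
    push_cast
    rw [show c * ((z : ℝ) - 1) = c * z - c by ring, show c * ((z : ℝ) + 1) = c * z + c by ring,
      Real.cosh_add, Real.cosh_sub]; ring

theorem fE_one {r t : ℝ} (hrt : r + 2 * t = 1) (n : ℕ) :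
    fE r t n (fun _ => 1) = 1 := by
  have := fE_cosh (r := r) (t := t) n 0
  simpa [hrt] using this

theorem fE_moment {r t : ℝ} (hr : 0 < r) (ht : 0 < t) (hrt : r + 2 * t = 1) (n : ℕ) (hn : 1 ≤ n)
    (k : ℕ) : fE r t n (fun z => |(z : ℝ)| ^ k) ≤ 6 * k.factorial * (Real.sqrt n) ^ k := by
  have hs : 0 < Real.sqrt n := Real.sqrt_pos.2 (by exact_mod_cast hn)
  set c := (Real.sqrt n)⁻¹ with hc
  have hc0 : 0 < c := by positivity
  have h1 : ∀ z : ℤ, |(z : ℝ)| ^ k ≤ (2 * k.factorial * (Real.sqrt n) ^ k) * Real.cosh (c * z) := by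
    intro z
    have h2 := Real.pow_div_factorial_le_exp (c * |(z : ℝ)|) (by positivity) k
    have h3 : Real.exp (c * |(z : ℝ)|) ≤ 2 * Real.cosh (c * z) := by
      rw [← Real.cosh_abs (c * z), abs_mul, abs_of_pos hc0, Real.cosh_eq]
      have := Real.exp_pos (-(c * |(z : ℝ)|))
      linarith
    have h4 : (c * |(z : ℝ)|) ^ k ≤ k.factorial * (2 * Real.cosh (c * z)) := by
      rw [div_le_iff₀ (by positivity)] at h2
      have : (0 : ℝ) < k.factorial := by positivity
      nlinarith
    have h5 : |(z : ℝ)| ^ k = (Real.sqrt n) ^ k * (c * |(z : ℝ)|) ^ k := by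
      rw [← mul_pow, ← mul_assoc, hc, mul_inv_cancel₀ hs.ne', one_mul]
    rw [h5]
    have : 0 < (Real.sqrt n) ^ k := by positivity
    nlinarith
  refine (fE_mono hr ht n h1).trans ?_
  rw [fE_smul, fE_cosh]
  have h6 : (r + 2 * t * Real.cosh c) ^ n ≤ 3 := by
    have h7 : r + 2 * t * Real.cosh c ≤ Real.exp (c ^ 2 / 2) := by
      have := Real.cosh_le_exp_half_sq c
      have := Real.one_le_cosh c
      nlinarith
    have h8 : 0 ≤ r + 2 * t * Real.cosh c := by
      have := Real.one_le_cosh c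
      positivity
    calc _ ≤ (Real.exp (c ^ 2 / 2)) ^ n := pow_le_pow_left₀ h8 h7 n
      _ = Real.exp (1 / 2) := by
        rw [← Real.exp_nat_mul, hc, inv_pow, Real.sq_sqrt (by positivity)]
        congr 1
        have : (n : ℝ) ≠ 0 := by positivity
        field_simp
      _ ≤ Real.exp 1 := Real.exp_le_exp.2 (by norm_num)
      _ ≤ 3 := by have := Real.exp_one_lt_d9; linarith
  have : (0 : ℝ) < 2 * k.factorial * (Real.sqrt n) ^ k := by positivity
  nlinarith

theorem pw_sup_aux {r t : ℝ} (hr : 0 < r) (ht : 0 < t) (n k : ℕ) (z : ℤ) (hz : 0 ≤ z) :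
    (z : ℝ) ^ k * pw r t n z ≤
      fE r t (n + 1) (fun z => |(z : ℝ)| ^ (k + 1)) / ((n + 1) * t) := by
  have hpos : (0 : ℝ) < (n + 1) * t := by positivity
  rw [le_div_iff₀ hpos]
  have tel : ∀ N : ℕ, pw r t n z * ((n + 1) * t) = ∑ i ∈ Finset.range N,
      (((z + 2 * i + 1 : ℤ) : ℝ) * pw r t (n + 1) (z + 2 * i + 1)) +
        pw r t n (z + 2 * N) * ((n + 1) * t) := by
    intro N
    induction N with
    | zero => simp
    | succ N ih =>
      rw [ih, Finset.sum_range_succ, pw_mul_z]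
      rw [show z + 2 * (N : ℤ) + 1 - 1 = z + 2 * N by ring,
        show z + 2 * (N : ℤ) + 1 + 1 = z + 2 * ((N + 1 : ℕ) : ℤ) by push_cast; ring]
      ring
  have h1 := tel (n + 1)
  rw [pw_zero_of_gt r t n (z + 2 * ((n + 1 : ℕ) : ℤ)) (by push_cast; grind), zero_mul, add_zero] at h1
  rw [mul_assoc, h1, Finset.mul_sum]
  have inj : Function.Injective (fun i : ℕ => z + 2 * (i : ℤ) + 1) := by
    intro i j h; simp at h; exact h
  calc _ ≤ ∑ i ∈ Finset.range (n + 1), pw r t (n + 1) (z + 2 * i + 1) *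
        |((z + 2 * i + 1 : ℤ) : ℝ)| ^ (k + 1) := by
        apply Finset.sum_le_sum
        intro i _
        have a1 : (0 : ℝ) ≤ ((z + 2 * i + 1 : ℤ) : ℝ) := by exact_mod_cast (by omega)
        have a2 : (z : ℝ) ≤ ((z + 2 * i + 1 : ℤ) : ℝ) := by exact_mod_cast (by omega)
        have a3 : (0 : ℝ) ≤ z := by exact_mod_cast hz
        rw [abs_of_nonneg a1]
        have a4 := pow_le_pow_left₀ a3 a2 k
        have a5 := pw_nonneg hr ht (n + 1) (z + 2 * i + 1)
        rw [pow_succ]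
        have a6 : 0 ≤ ((z + 2 * i + 1 : ℤ) : ℝ) * pw r t (n + 1) (z + 2 * i + 1) := by positivity
        nlinarith
    _ = ∑ w ∈ (Finset.range (n + 1)).map ⟨_, inj⟩, pw r t (n + 1) w * |(w : ℝ)| ^ (k + 1) := by
        rw [Finset.sum_map]; rfl
    _ ≤ _ := by
        apply Summable.sum_le_tsum _ _ (pw_summable _ _ _ _)
        intro w _
        have := pw_nonneg hr ht (n + 1) w
        positivity

theorem pw_sup {r t : ℝ} (hr : 0 < r) (ht : 0 < t) (hrt : r + 2 * t = 1) (n k : ℕ) (z : ℤ) :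
    |(z : ℝ)| ^ k * pw r t n z * (n + 1) ≤
      6 * (k + 1).factorial * (Real.sqrt (n + 1)) ^ (k + 1) / t := by
  have key : ∀ z : ℤ, 0 ≤ z → (z : ℝ) ^ k * pw r t n z * (n + 1) ≤
      6 * (k + 1).factorial * (Real.sqrt (n + 1)) ^ (k + 1) / t := by
    intro z hz
    have h1 := pw_sup_aux hr ht n k z hz
    have h2 := fE_moment hr ht hrt (n + 1) (by omega) (k + 1)
    rw [le_div_iff₀ (by positivity)] at h1
    rw [le_div_iff₀ (by positivity)]
    push_cast at h2
    linarith
  rcases le_total 0 z with h | h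
  · rw [abs_of_nonneg (by exact_mod_cast h)]; exact key z h
  · rw [abs_of_nonpos (by exact_mod_cast h), ← pw_neg]
    have := key (-z) (by omega)
    push_cast at this; exact this

def q2 (r t : ℝ) (n : ℕ) (z : ℤ) : ℝ := pw r t n (z - 2) - 2 * pw r t n z + pw r t n (z + 2)

def q3 (r t : ℝ) (n : ℕ) (z : ℤ) : ℝ := q2 r t n (z - 1) - q2 r t n (z + 1)

theorem q2_id (r t : ℝ) (n : ℕ) (z : ℤ) :
    (n + 1) * (n + 2) * t ^ 2 * q2 r t n z = z ^ 2 * pw r t (n + 2) z -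
      (n + 2) * (pw r t (n + 2) z - r * pw r t (n + 1) z) := by
  have e1 := pw_mul_z r t n (z - 1)
  have e2 := pw_mul_z r t n (z + 1)
  have e3 := pw_mul_z r t (n + 1) z
  have e4 := pw_succ r t (n + 1) z
  unfold q2
  rw [show z - 1 - 1 = z - 2 by ring, show z - 1 + 1 = z by ring] at e1
  rw [show z + 1 - 1 = z by ring, show z + 1 + 1 = z + 2 by ring] at e2
  simp only [show n + 1 + 1 = n + 2 by ring] at *
  push_cast at *
  linear_combination - (n + 2) * t * e1 + (n + 2) * t * e2 - z * e3 + (n + 2) * e4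

theorem q3_id (r t : ℝ) (n : ℕ) (z : ℤ) :
    (n + 1) * (n + 2) * (n + 3) * t ^ 3 * q3 r t n z = (z ^ 2 + 1) * z * pw r t (n + 3) z -
      2 * z * (n + 3) * (pw r t (n + 3) z - r * pw r t (n + 2) z) -
      (n + 2) * z * pw r t (n + 3) z + (n + 3) * r * z * pw r t (n + 2) z := by
  have e1 := q2_id r t n (z - 1)
  have e2 := q2_id r t n (z + 1)
  have e3 := pw_mul_z r t (n + 2) z
  have e4 := pw_succ r t (n + 2) z
  have e5 := pw_mul_z r t (n + 1) z
  unfold q3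
  simp only [show n + 1 + 1 = n + 2 by ring, show n + 2 + 1 = n + 3 by ring] at *
  push_cast at *
  linear_combination (n + 3) * t * e1 - (n + 3) * t * e2 - (z ^ 2 + 1 - (n + 2)) * e3
    + 2 * z * (n + 3) * e4 - (n + 3) * r * e5

theorem abs4 (a b c d : ℝ) : |a - b - c + d| ≤ |a| + |b| + |c| + |d| := by
  have h1 := abs_add_le (a - b - c) d
  have h2 := abs_sub (a - b) c
  have h3 := abs_sub a b
  linarith

theorem q3_bound {r t : ℝ} (hr : 0 < r) (ht : 0 < t) (hrt : r + 2 * t = 1) :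
    ∃ C : ℝ, 0 < C ∧ ∀ (n : ℕ) (z : ℤ), |(z : ℝ)| ^ 4 * |q3 r t n z| ≤ C := by
  refine ⟨64 * (6 * 40320 + 7 * (6 * 720)) / t ^ 4, by positivity, ?_⟩
  intro n z
  have b7 := pw_sup hr ht hrt (n + 3) 7 z
  have b5 := pw_sup hr ht hrt (n + 3) 5 z
  have b5' := pw_sup hr ht hrt (n + 2) 5 z
  have sq : ∀ x : ℝ, 0 ≤ x → Real.sqrt x ^ 8 = x ^ 4 ∧ Real.sqrt x ^ 6 = x ^ 3 := by
    intro x hx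
    have := Real.sq_sqrt hx
    constructor
    · calc Real.sqrt x ^ 8 = (Real.sqrt x ^ 2) ^ 4 := by ring
        _ = _ := by rw [this]
    · calc Real.sqrt x ^ 6 = (Real.sqrt x ^ 2) ^ 3 := by ring
        _ = _ := by rw [this]
  have f8 : ((7 + 1).factorial : ℝ) = 40320 := by norm_num [Nat.factorial]
  have f6 : ((5 + 1).factorial : ℝ) = 720 := by norm_num [Nat.factorial]
  rw [f8, show 7 + 1 = 8 by rfl, (sq _ (by positivity)).1, le_div_iff₀ ht] at b7
  rw [f6, show 5 + 1 = 6 by rfl, (sq _ (by positivity)).2, le_div_iff₀ ht] at b5 b5'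
  push_cast at b7 b5 b5'
  have n0 : (0 : ℝ) ≤ n := by positivity
  set m : ℝ := (n : ℝ) with hm
  set u := |(z : ℝ)| with hu
  have hu0 : 0 ≤ u := abs_nonneg _
  set P3 := pw r t (n + 3) z
  set P2 := pw r t (n + 2) z
  have hP3 : 0 ≤ P3 := pw_nonneg hr ht _ _
  have hP2 : 0 ≤ P2 := pw_nonneg hr ht _ _
  have c7 : u ^ 7 * P3 * t ≤ 6 * 40320 * (m + 4) ^ 3 := by
    have : 0 < m + 4 := by positivity
    refine le_of_mul_le_mul_right ?_ this
    linarith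
  have c5 : u ^ 5 * P3 * t ≤ 6 * 720 * (m + 4) ^ 2 := by
    have : 0 < m + 4 := by positivity
    refine le_of_mul_le_mul_right ?_ this
    linarith
  have c5' : u ^ 5 * P2 * t ≤ 6 * 720 * (m + 4) ^ 2 := by
    have : 0 < m + 3 := by positivity
    have : u ^ 5 * P2 * t ≤ 6 * 720 * (m + 3) ^ 2 := by
      refine le_of_mul_le_mul_right ?_ this
      linarith
    nlinarith
  have hr1 : r ≤ 1 := by linarith
  have id := q3_id r t n z
  have habs : (m + 1) * (m + 2) * (m + 3) * t ^ 3 * |q3 r t n z| ≤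
      (u ^ 2 + 1) * u * P3 + 2 * u * (m + 3) * (P3 + P2) + (m + 2) * u * P3 + (m + 3) * u * P2 := by
    have h0 : 0 ≤ (m + 1) * (m + 2) * (m + 3) * t ^ 3 := by positivity
    rw [← abs_of_nonneg h0, ← abs_mul, id]
    have z2 : (z : ℝ) ^ 2 = u ^ 2 := by rw [hu, sq_abs]
    have t1 : |((z : ℝ) ^ 2 + 1) * z * P3| = (u ^ 2 + 1) * u * P3 := by
      rw [abs_mul, abs_mul, z2, abs_of_nonneg hP3, abs_of_nonneg (by positivity : 0 ≤ u ^ 2 + 1)]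
    have t2 : |2 * (z : ℝ) * (m + 3) * (P3 - r * P2)| ≤ 2 * u * (m + 3) * (P3 + P2) := by
      rw [abs_mul, abs_mul, abs_mul, abs_of_nonneg (by positivity : 0 ≤ m + 3), abs_two]
      apply mul_le_mul_of_nonneg_left _ (by positivity)
      rw [abs_le]; constructor <;> nlinarith
    have t3 : |(m + 2) * (z : ℝ) * P3| = (m + 2) * u * P3 := by
      rw [abs_mul, abs_mul, abs_of_nonneg hP3, abs_of_nonneg (by positivity : 0 ≤ m + 2)]
    have t4 : |(m + 3) * r * (z : ℝ) * P2| ≤ (m + 3) * u * P2 := by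
      rw [abs_mul, abs_mul, abs_mul, abs_of_nonneg hP2, abs_of_nonneg (by positivity : 0 ≤ m + 3),
        abs_of_pos hr]
      have : 0 ≤ (m + 3) * u * P2 := by positivity
      nlinarith
    have := abs4 (((z : ℝ) ^ 2 + 1) * z * P3) (2 * (z : ℝ) * (m + 3) * (P3 - r * P2))
      ((m + 2) * (z : ℝ) * P3) ((m + 3) * r * (z : ℝ) * P2)
    rw [t1, t3] at this
    linarith
  have h1 : u ^ 4 * ((m + 1) * (m + 2) * (m + 3) * t ^ 3 * |q3 r t n z|) * t ≤
      (6 * 40320 + 7 * (6 * 720)) * (m + 4) ^ 3 := by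
    calc _ ≤ u ^ 4 * ((u ^ 2 + 1) * u * P3 + 2 * u * (m + 3) * (P3 + P2) +
          (m + 2) * u * P3 + (m + 3) * u * P2) * t := by gcongr
      _ = u ^ 7 * P3 * t + (1 + 2 * (m + 3) + (m + 2)) * (u ^ 5 * P3 * t) +
          (3 * (m + 3)) * (u ^ 5 * P2 * t) := by ring
      _ ≤ 6 * 40320 * (m + 4) ^ 3 + (1 + 2 * (m + 3) + (m + 2)) * (6 * 720 * (m + 4) ^ 2) +
          (3 * (m + 3)) * (6 * 720 * (m + 4) ^ 2) := by gcongr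
      _ ≤ _ := by nlinarith [sq_nonneg (m + 4), mul_nonneg n0 (sq_nonneg (m + 4))]
  have h2 : (m + 4) ^ 3 ≤ 64 * ((m + 1) * (m + 2) * (m + 3)) := by
    nlinarith [mul_nonneg n0 n0, mul_nonneg n0 (mul_nonneg n0 n0)]
  rw [le_div_iff₀ (by positivity)]
  have hpos : 0 < (m + 1) * (m + 2) * (m + 3) := by positivity
  refine le_of_mul_le_mul_right ?_ hpos
  calc _ = u ^ 4 * ((m + 1) * (m + 2) * (m + 3) * t ^ 3 * |q3 r t n z|) * t := by ring
    _ ≤ _ := h1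
    _ ≤ (6 * 40320 + 7 * (6 * 720)) * (64 * ((m + 1) * (m + 2) * (m + 3))) :=
      mul_le_mul_of_nonneg_left h2 (by norm_num)
    _ = _ := by ring

def g2 (r t : ℝ) (n : ℕ) (z : ℤ) : ℝ := q2 r t n (z + 1) - q2 r t n z

theorem g2_bound {r t : ℝ} (hr : 0 < r) (ht : 0 < t) (hrt : r + 2 * t = 1) :
    ∃ C : ℝ, 0 < C ∧ ∀ (n : ℕ) (z : ℤ), |(z : ℝ)| ^ 4 * |g2 r t n z| ≤ C := by
  obtain ⟨C, hC, hq⟩ := q3_bound hr ht hrt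
  have hq8 : ∀ n z, |q3 r t n z| ≤ 8 := by
    intro n z
    unfold q3 q2
    have a := fun z => pw_nonneg hr ht n z
    have b := fun z => pw_le_one hr ht hrt n z
    have := a (z-1-2); have := a (z-1); have := a (z-1+2); have := a (z+1-2); have := a (z+1)
    have := a (z+1+2)
    have := b (z-1-2); have := b (z-1); have := b (z-1+2); have := b (z+1-2); have := b (z+1)
    have := b (z+1+2)
    rw [abs_le]; constructor <;> linarith
  set C' : ℝ := 16 * (C + 8) + C with hC'
  have hrec : ∀ n z, g2 r t (n + 1) z = (1 - 4 * t) * g2 r t n z -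
      t * (q3 r t n (z + 1) + q3 r t n z) := by
    intro n z
    have : r = 1 - 2 * t := by linarith
    unfold g2 q3 q2
    simp only [pw_succ]
    subst this
    ring_nf
  have hstep : ∀ n (z : ℤ), |(z : ℝ)| ^ 4 * |q3 r t n (z + 1) + q3 r t n z| ≤ C' := by
    intro n z
    have h1 := hq n (z + 1)
    have h2 := hq n z
    have h3 := hq8 n (z + 1)
    push_cast at h1
    have h4 : |(z : ℝ)| ^ 4 ≤ 16 * (|(z : ℝ) + 1| ^ 4 + 1) := by
      have a1 : |(z : ℝ)| ≤ |(z : ℝ) + 1| + 1 := by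
        have := abs_sub (z + 1 : ℝ) 1
        simpa using this
      have a2 := pow_le_pow_left₀ (abs_nonneg _) a1 4
      have a3 := abs_nonneg ((z : ℝ) + 1)
      set v := |(z : ℝ) + 1|
      have : (v + 1) ^ 4 ≤ 16 * (v ^ 4 + 1) := by
        nlinarith [sq_nonneg (v - 1), sq_nonneg (v ^ 2 - 1), sq_nonneg (v ^ 2 - v), sq_nonneg (v * (v - 1)), sq_nonneg ((v-1)*(v+1)), sq_nonneg v, mul_nonneg a3 (sq_nonneg (v-1))]
      linarith
    have h5 : |(z : ℝ)| ^ 4 * |q3 r t n (z + 1)| ≤ 16 * (C + 8) := by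
      have := mul_le_mul_of_nonneg_right h4 (abs_nonneg (q3 r t n (z + 1)))
      linarith
    have h6 := mul_le_mul_of_nonneg_left (abs_add_le (q3 r t n (z + 1)) (q3 r t n z))
      (by positivity : 0 ≤ |(z : ℝ)| ^ 4)
    rw [hC']; linarith
  have hrr : |1 - 4 * t| < 1 := by rw [abs_lt]; constructor <;> linarith
  set ρ := |1 - 4 * t| with hρ
  have hC'0 : 0 < C' := by positivity
  refine ⟨(C' + 1000) / (1 - ρ), div_pos (by positivity) (by linarith), ?_⟩
  intro n
  induction n with
  | zero =>
    intro z
    have hb : (1000 : ℝ) ≤ (C' + 1000) / (1 - ρ) := by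
      rw [le_div_iff₀ (by linarith)]
      have := abs_nonneg (1 - 4 * t)
      nlinarith
    refine le_trans ?_ hb
    by_cases hz : |z| ≤ 3
    · have h1 : |(z : ℝ)| ≤ 3 := by exact_mod_cast hz
      have h2 := pow_le_pow_left₀ (abs_nonneg _) h1 4
      have h3 : |g2 r t 0 z| ≤ 8 := by
        unfold g2 q2
        have a := fun z => pw_nonneg hr ht 0 z
        have b := fun z => pw_le_one hr ht hrt 0 z
        have := a (z-2); have := a (z); have := a (z+2); have := a (z+1-2); have := a (z+1)
        have := a (z+1+2)
        have := b (z-2); have := b (z); have := b (z+2); have := b (z+1-2); have := b (z+1)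
        have := b (z+1+2)
        rw [abs_le]; constructor <;> linarith
      calc _ ≤ (3 : ℝ) ^ 4 * 8 := by gcongr
        _ ≤ 1000 := by norm_num
    · have : g2 r t 0 z = 0 := by
        unfold g2 q2
        simp only [pw]
        have h0 : z ≠ 0 := by grind
        have h1 : z + 1 ≠ 0 := by grind
        have h2 : z - 2 ≠ 0 := by grind
        have h3 : z + 2 ≠ 0 := by grind
        have h4 : z + 1 - 2 ≠ 0 := by grind
        have h5 : z + 1 + 2 ≠ 0 := by grind
        simp [*]
      rw [this]; simp
  | succ n ih =>
    intro z
    rw [hrec]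
    have h1 := ih z
    have h2 := hstep n z
    have h3 : |(1 - 4 * t) * g2 r t n z - t * (q3 r t n (z + 1) + q3 r t n z)| ≤
        ρ * |g2 r t n z| + t * |q3 r t n (z + 1) + q3 r t n z| := by
      refine (abs_sub _ _).trans ?_
      rw [abs_mul, abs_mul, abs_of_pos ht]
    have h4 := mul_le_mul_of_nonneg_left h3 (by positivity : 0 ≤ |(z : ℝ)| ^ 4)
    have hρ0 : 0 ≤ ρ := abs_nonneg _
    have h5 := mul_le_mul_of_nonneg_left h1 hρ0
    have h6 := mul_le_mul_of_nonneg_left h2 ht.le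
    have h7 : ρ * ((C' + 1000) / (1 - ρ)) + (C' + 1000) = (C' + 1000) / (1 - ρ) := by
      have : 1 - ρ ≠ 0 := by linarith
      field_simp; ring
    have h8 : t * C' ≤ C' := by nlinarith
    linarith

abbrev St := ℤ × ℤ × ℤ

def stp (s : St) (d : ℤ) : St := (min s.1 (s.2.2 + d), max s.2.1 (s.2.2 + d), s.2.2 + d)

def TT (r t : ℝ) : (St → ℝ) →ₗ[ℝ] (St → ℝ) where
  toFun F := fun s => r * F (stp s 0) + t * (F (stp s 1) + F (stp s (-1)))
  map_add' F F' := by ext s; simp only [Pi.add_apply]; ring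
  map_smul' c F := by ext s; simp only [Pi.smul_apply, smul_eq_mul, RingHom.id_apply]; ring

theorem TT_apply (r t : ℝ) (F : St → ℝ) (s : St) :
    TT r t F s = r * F (stp s 0) + t * (F (stp s 1) + F (stp s (-1))) := rfl

def EE (r t : ℝ) (n : ℕ) : (St → ℝ) →ₗ[ℝ] ℝ :=
  (LinearMap.proj ((0, 0, 0) : St)) ∘ₗ ((TT r t) ^ n)

theorem EE_apply (r t : ℝ) (n : ℕ) (F : St → ℝ) : EE r t n F = ((TT r t) ^ n) F (0, 0, 0) := rfl

theorem EE_zero (r t : ℝ) (F : St → ℝ) : EE r t 0 F = F (0, 0, 0) := rfl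

theorem EE_succ (r t : ℝ) (n : ℕ) (F : St → ℝ) : EE r t (n + 1) F = EE r t n (TT r t F) := by
  rw [EE_apply, EE_apply, pow_succ]; rfl

def Rch (k : ℕ) (s : St) : Prop :=
  -(k : ℤ) ≤ s.1 ∧ s.2.1 ≤ k ∧ s.1 ≤ s.2.2 ∧ s.2.2 ≤ s.2.1 ∧ s.1 ≤ 0 ∧ 0 ≤ s.2.1

theorem Rch_stp (k : ℕ) (s : St) (d : ℤ) (hd : -1 ≤ d) (hd' : d ≤ 1) (h : Rch k s) :
    Rch (k + 1) (stp s d) := by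
  unfold Rch stp at *
  push_cast
  grind

theorem TTpow_mono {r t : ℝ} (hr : 0 < r) (ht : 0 < t) (n : ℕ) : ∀ (k : ℕ) (s : St) (F F' : St → ℝ),
    Rch k s → (∀ s', Rch (k + n) s' → F s' ≤ F' s') →
      ((TT r t) ^ n) F s ≤ ((TT r t) ^ n) F' s := by
  induction n with
  | zero => intro k s F F' hs h; exact h s hs
  | succ n ih =>
    intro k s F F' hs h
    rw [pow_succ']
    change TT r t (((TT r t) ^ n) F) s ≤ TT r t (((TT r t) ^ n) F') s
    rw [TT_apply, TT_apply]
    have key : ∀ d : ℤ, -1 ≤ d → d ≤ 1 →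
        ((TT r t) ^ n) F (stp s d) ≤ ((TT r t) ^ n) F' (stp s d) := by
      intro d h1 h2
      apply ih (k + 1) _ F F' (Rch_stp k s d h1 h2 hs)
      intro s' hs'
      apply h
      rwa [show k + (n + 1) = k + 1 + n by ring]
    have := key 0 (by norm_num) (by norm_num)
    have := key 1 (by norm_num) (by norm_num)
    have := key (-1) (by norm_num) (by norm_num)
    gcongr

theorem EE_mono {r t : ℝ} (hr : 0 < r) (ht : 0 < t) (n : ℕ) (F F' : St → ℝ)
    (h : ∀ s, Rch n s → F s ≤ F' s) : EE r t n F ≤ EE r t n F' := by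
  rw [EE_apply, EE_apply]
  apply TTpow_mono hr ht n 0
  · simp [Rch]
  · simpa using h

theorem EE_congr {r t : ℝ} (hr : 0 < r) (ht : 0 < t) (n : ℕ) (F F' : St → ℝ)
    (h : ∀ s, Rch n s → F s = F' s) : EE r t n F = EE r t n F' :=
  le_antisymm (EE_mono hr ht n _ _ fun s hs => (h s hs).le)
    (EE_mono hr ht n _ _ fun s hs => (h s hs).ge)

theorem EE_nonneg {r t : ℝ} (hr : 0 < r) (ht : 0 < t) (n : ℕ) (F : St → ℝ)
    (h : ∀ s, Rch n s → 0 ≤ F s) : 0 ≤ EE r t n F := by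
  have := EE_mono hr ht n 0 F h
  simpa using this

theorem EE_pos {r t : ℝ} (n : ℕ) (f : ℤ → ℝ) :
    EE r t n (fun s => f s.2.2) = fE r t n f := by
  induction n generalizing f with
  | zero => rw [EE_zero, fE_zero]
  | succ n ih =>
    rw [EE_succ, fE_succ, ← ih]
    congr 1; ext s
    rw [TT_apply]; simp only [stp]
    rw [add_zero, ← sub_eq_add_neg]; ring

theorem EE_top {r t : ℝ} (hr : 0 < r) (ht : 0 < t) (n : ℕ) (f : ℤ → ℝ) (hf : ∀ z, f (-1 - z) = f z) :
    EE r t n (fun s => f (s.2.1 - s.2.2)) = fE r t n f := by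
  induction n generalizing f with
  | zero => rw [EE_zero, fE_zero]; simp
  | succ n ih =>
    rw [EE_succ, fE_succ, ← ih]
    · apply EE_congr hr ht
      intro s hs
      obtain ⟨a, b, x⟩ := s
      simp only [Rch] at hs
      rw [TT_apply]; simp only [stp]
      have e0 : max b (x + 0) - (x + 0) = b - x := by omega
      have e1 : max b (x + -1) - (x + -1) = b - x + 1 := by omega
      rw [e0, e1]
      by_cases hx : x = b
      · have e2 : max b (x + 1) - (x + 1) = 0 := by omega
        rw [e2]
        have := hf 0
        simp at this
        subst hx; simp [this]
      · have e2 : max b (x + 1) - (x + 1) = b - x - 1 := by omega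
        rw [e2]
    · intro z
      have h1 := hf z
      have h2 := hf (z - 1)
      have h3 := hf (z + 1)
      rw [h1, ← h2, ← h3]
      rw [show -1 - (z - 1) = -1 - z + 1 by ring, show -1 - (z + 1) = -1 - z - 1 by ring]; ring

theorem EE_bot {r t : ℝ} (hr : 0 < r) (ht : 0 < t) (n : ℕ) (f : ℤ → ℝ) (hf : ∀ z, f (-1 - z) = f z) :
    EE r t n (fun s => f (s.2.2 - s.1)) = fE r t n f := by
  induction n generalizing f with
  | zero => rw [EE_zero, fE_zero]; simp
  | succ n ih =>
    rw [EE_succ, fE_succ, ← ih]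
    · apply EE_congr hr ht
      intro s hs
      obtain ⟨a, b, x⟩ := s
      simp only [Rch] at hs
      rw [TT_apply]; simp only [stp]
      have e0 : x + 0 - min a (x + 0) = x - a := by omega
      have e1 : x + 1 - min a (x + 1) = x - a + 1 := by omega
      rw [e0, e1]
      by_cases hx : x = a
      · have e2 : x + -1 - min a (x + -1) = 0 := by omega
        rw [e2]
        have := hf 0
        simp at this
        subst hx; simp only [sub_self, zero_sub, zero_add, this]; ring
      · have e2 : x + -1 - min a (x + -1) = x - a - 1 := by omega
        rw [e2]; ring
    · intro z
      have h1 := hf z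
      have h2 := hf (z - 1)
      have h3 := hf (z + 1)
      rw [h1, ← h2, ← h3]
      rw [show -1 - (z - 1) = -1 - z + 1 by ring, show -1 - (z + 1) = -1 - z - 1 by ring]; ring

/-- indicator of staying in `[a,b]` and ending at `y` -/
def KI (a b y : ℤ) (s : St) : ℝ := if a ≤ s.1 ∧ s.2.1 ≤ b ∧ s.2.2 = y then 1 else 0

theorem KK_succ (r t : ℝ) (n : ℕ) (a b y : ℤ) (hay : a ≤ y) (hyb : y ≤ b) :
    EE r t (n + 1) (KI a b y) = r * EE r t n (KI a b y) +
      t * (EE r t n (KI a b (y - 1)) + EE r t n (KI a b (y + 1))) := by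
  rw [EE_succ]
  have : TT r t (KI a b y) = r • KI a b y + t • (KI a b (y - 1) + KI a b (y + 1)) := by
    ext s
    obtain ⟨a', b', x⟩ := s
    simp only [TT_apply, stp, KI, Pi.add_apply, Pi.smul_apply, smul_eq_mul]
    have e0 : (a ≤ min a' (x + 0) ∧ max b' (x + 0) ≤ b ∧ x + 0 = y) ↔ (a ≤ a' ∧ b' ≤ b ∧ x = y) := by
      omega
    have e1 : (a ≤ min a' (x + 1) ∧ max b' (x + 1) ≤ b ∧ x + 1 = y) ↔
      (a ≤ a' ∧ b' ≤ b ∧ x = y - 1) := by omega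
    have e2 : (a ≤ min a' (x + -1) ∧ max b' (x + -1) ≤ b ∧ x + -1 = y) ↔
      (a ≤ a' ∧ b' ≤ b ∧ x = y + 1) := by omega
    simp only [e0, e1, e2]
  rw [this]; simp only [map_add, map_smul, smul_eq_mul]

theorem KK_zero_wall {r t : ℝ} (hr : 0 < r) (ht : 0 < t) (n : ℕ) (a b y : ℤ) (h : y < a ∨ b < y) :
    EE r t n (KI a b y) = 0 := by
  rw [EE_congr hr ht n _ 0, map_zero]
  intro s hs
  simp only [KI, Rch] at *
  rw [if_neg]; rfl
  omega

/-- periodized free kernel -/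
def th (r t : ℝ) (n : ℕ) (L y : ℤ) : ℝ := ∑' j : ℤ, pw r t n (y + 2 * j * L)

theorem th_summable (r t : ℝ) (n : ℕ) (L y : ℤ) (hL : 1 ≤ L) :
    Summable (fun j : ℤ => pw r t n (y + 2 * j * L)) := by
  apply summable_of_hasFiniteSupport
  have : Function.Injective (fun j : ℤ => y + 2 * j * L) := by
    intro i j h
    simp only [add_right_inj] at h
    have := mul_right_cancel₀ (by omega : L ≠ 0) h
    omega
  exact (pw_supp_finite r t n).preimage (this.injOn)

theorem th_succ (r t : ℝ) (n : ℕ) (L y : ℤ) (hL : 1 ≤ L) :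
    th r t (n + 1) L y = r * th r t n L y + t * (th r t n L (y - 1) + th r t n L (y + 1)) := by
  unfold th
  have s0 := th_summable r t n L y hL
  have s1 := th_summable r t n L (y - 1) hL
  have s2 := th_summable r t n L (y + 1) hL
  rw [← Summable.tsum_add s1 s2, ← tsum_mul_left, ← tsum_mul_left,
    ← Summable.tsum_add (s0.mul_left r) ((s1.add s2).mul_left t)]
  congr 1; ext j
  rw [pw_succ, show y + 2 * j * L - 1 = y - 1 + 2 * j * L by ring,
    show y + 2 * j * L + 1 = y + 1 + 2 * j * L by ring]

theorem th_period (r t : ℝ) (n : ℕ) (L y : ℤ) : th r t n L (y + 2 * L) = th r t n L y := by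
  unfold th
  rw [← (Equiv.addRight (1 : ℤ)).tsum_eq (fun j : ℤ => pw r t n (y + 2 * j * L))]
  congr 1; ext j
  simp only [Equiv.coe_addRight]
  congr 1; ring

theorem th_zero_zero (r t : ℝ) (L : ℤ) (hL : 1 ≤ L) : th r t 0 L 0 = 1 := by
  unfold th
  rw [tsum_eq_single 0]
  · simp [pw]
  · intro j hj
    have : L ≠ 0 := by omega
    simp [pw, hj, this]

theorem th_zero_ne (r t : ℝ) (L y : ℤ) (h0 : y ≠ 0) (h1 : -2 * L < y) (h2 : y < 2 * L) :
    th r t 0 L y = 0 := by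
  unfold th
  convert tsum_zero with j
  simp only [pw]
  rw [if_neg]
  intro h
  rcases lt_trichotomy j 0 with hj | hj | hj
  · nlinarith
  · subst hj; simp at h; exact h0 h
  · nlinarith

theorem KK_refl {r t : ℝ} (hr : 0 < r) (ht : 0 < t) (n : ℕ) (a b : ℤ) (ha : a - 1 ≤ 0) (hb : 0 ≤ b + 1)
    (hL : 1 ≤ b - a + 2) : ∀ (y : ℤ), a - 1 ≤ y → y ≤ b + 1 →
    EE r t n (KI a b y) = th r t n (b - a + 2) y - th r t n (b - a + 2) (2 * (b + 1) - y) := by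
  have wall : ∀ n y, y = a - 1 ∨ y = b + 1 → EE r t n (KI a b y) =
      th r t n (b - a + 2) y - th r t n (b - a + 2) (2 * (b + 1) - y) := by
    intro n y hy
    rw [KK_zero_wall hr ht n a b y (by omega)]
    rcases hy with rfl | rfl
    · rw [show 2 * (b + 1) - (a - 1) = (a - 1) + 2 * (b - a + 2) by ring, th_period]; ring
    · rw [show 2 * (b + 1) - (b + 1) = b + 1 by ring]; ring
  induction n with
  | zero =>
    intro y h1 h2
    by_cases hy : y = a - 1 ∨ y = b + 1
    · exact wall 0 y hy
    rw [EE_zero]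
    simp only [KI]
    rw [th_zero_ne r t _ (2 * (b + 1) - y) (by omega) (by omega) (by omega)]
    by_cases h0 : y = 0
    · subst h0
      rw [th_zero_zero _ _ _ hL, if_pos (by omega)]; ring
    · rw [th_zero_ne r t _ y h0 (by omega) (by omega), if_neg (by omega)]; ring
  | succ n ih =>
    intro y h1 h2
    by_cases hy : y = a - 1 ∨ y = b + 1
    · exact wall _ y hy
    rw [KK_succ r t n a b y (by omega) (by omega), th_succ _ _ _ _ _ hL, th_succ _ _ _ _ _ hL,
      ih y h1 h2, ih (y - 1) (by omega) (by omega), ih (y + 1) (by omega) (by omega)]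
    rw [show 2 * (b + 1) - (y - 1) = 2 * (b + 1) - y + 1 by ring,
      show 2 * (b + 1) - (y + 1) = 2 * (b + 1) - y - 1 by ring]
    ring

/-- probability that range is `[a,b]` and end is `y` -/
def GI (a b y : ℤ) (s : St) : ℝ := if s.1 = a ∧ s.2.1 = b ∧ s.2.2 = y then 1 else 0

theorem GI_eq (a b y : ℤ) :
    GI a b y = KI a b y - KI (a + 1) b y - KI a (b - 1) y + KI (a + 1) (b - 1) y := by
  ext s
  obtain ⟨a', b', x⟩ := s
  simp only [GI, KI, Pi.add_apply, Pi.sub_apply]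
  by_cases hx : x = y
  · rcases lt_trichotomy a a' with h | h | h <;> rcases lt_trichotomy b b' with h' | h' | h' <;>
      (split_ifs <;> first | omega | norm_num)
  · simp [hx]

theorem dd1 (f : ℤ → ℝ) (M : ℝ) (e : ℤ) (k : ℕ)
    (h : ∀ w, e ≤ w → w ≤ e + 2 * k → |f (w - 2) - 2 * f w + f (w + 2)| ≤ M) :
    |f e - f (e + 2) - f (e + 2 * k) + f (e + 2 * k + 2)| ≤ k * M := by
  induction k with
  | zero => simp
  | succ k ih =>
    have h1 := ih (fun w hw hw' => h w hw (by push_cast; omega))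
    have h2 := h (e + 2 * (k + 1 : ℕ)) (by push_cast; omega) (by omega)
    push_cast at *
    rw [show e + 2 * ((k : ℤ) + 1) - 2 = e + 2 * k by ring] at h2
    rw [show e + 2 * (k : ℤ) + 2 = e + 2 * (k + 1) by ring] at h1
    have := abs_add_le (f e - f (e + 2) - f (e + 2 * k) + f (e + 2 * (k + 1)))
      (f (e + 2 * k) - 2 * f (e + 2 * (k + 1)) + f (e + 2 * (k + 1) + 2))
    rw [show f e - f (e + 2) - f (e + 2 * (k + 1)) + f (e + 2 * (k + 1) + 2) =
      (f e - f (e + 2) - f (e + 2 * k) + f (e + 2 * (k + 1))) +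
      (f (e + 2 * k) - 2 * f (e + 2 * (k + 1)) + f (e + 2 * (k + 1) + 2)) by ring]
    linarith

theorem dd2 (f : ℤ → ℝ) (M : ℝ) (e : ℤ) (i k : ℕ)
    (h : ∀ w, e ≤ w → w ≤ e + 2 * i + 2 * k → |f (w - 2) - 2 * f w + f (w + 2)| ≤ M) :
    |f e - f (e + 2 * i) - f (e + 2 * k) + f (e + 2 * i + 2 * k)| ≤ i * k * M := by
  induction i with
  | zero => simp
  | succ i ih =>
    have h1 := ih (fun w hw hw' => h w hw (by push_cast; omega))
    have h2 := dd1 f M (e + 2 * i) k (fun w hw hw' => h w (by omega) (by push_cast; omega))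
    push_cast at *
    rw [show e + 2 * ((i : ℤ) + 1) = e + 2 * i + 2 by ring]
    rw [show e + 2 * (i : ℤ) + 2 + 2 * k = e + 2 * i + 2 * k + 2 by ring]
    have := abs_add_le (f e - f (e + 2 * i) - f (e + 2 * k) + f (e + 2 * i + 2 * k))
      (f (e + 2 * i) - f (e + 2 * i + 2) - f (e + 2 * i + 2 * k) + f (e + 2 * i + 2 * k + 2))
    rw [show f e - f (e + 2 * i + 2) - f (e + 2 * k) + f (e + 2 * i + 2 * k + 2) =
      (f e - f (e + 2 * i) - f (e + 2 * k) + f (e + 2 * i + 2 * k)) +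
      (f (e + 2 * i) - f (e + 2 * i + 2) - f (e + 2 * i + 2 * k) + f (e + 2 * i + 2 * k + 2)) by ring]
    linarith

def fw (r t : ℝ) (n : ℕ) (w : ℤ) : ℝ := pw r t n (w + 1) - pw r t n w

theorem fw_dd (r t : ℝ) (n : ℕ) (w : ℤ) :
    fw r t n (w - 2) - 2 * fw r t n w + fw r t n (w + 2) = g2 r t n w := by
  unfold fw g2 q2
  rw [show w - 2 + 1 = w + 1 - 2 by ring, show w + 2 + 1 = w + 1 + 2 by ring]; ring

theorem fw_bound {r t C : ℝ}
    (hC : ∀ (n : ℕ) (z : ℤ), |(z : ℝ)| ^ 4 * |g2 r t n z| ≤ C) (hC0 : 0 < C) (n : ℕ)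
    (e : ℤ) (i k : ℕ) (j D : ℤ) (hD : 1 ≤ D) (hj : j ≠ 0) (hik : i * k ≤ 2 * j.natAbs ^ 2)
    (hw : 0 < i → 0 < k → (|j| * D ≤ e ∨ e + 2 * i + 2 * k ≤ - (|j| * D))) :
    |fw r t n e - fw r t n (e + 2 * i) - fw r t n (e + 2 * k) + fw r t n (e + 2 * i + 2 * k)| ≤
      (2 * C / (D : ℝ) ^ 4) * (1 / (j : ℝ) ^ 2) := by
  have hDr : (0 : ℝ) < D := by exact_mod_cast hD
  have hjr : (0 : ℝ) < |(j : ℝ)| := by simpa using hj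
  rcases Nat.eq_zero_or_pos i with rfl | hi
  · simp; positivity
  rcases Nat.eq_zero_or_pos k with rfl | hk
  · simp; positivity
  have hw' := hw hi hk
  have hX : (0 : ℝ) < |(j : ℝ)| * D := by positivity
  have := dd2 (fw r t n) (C / (|(j : ℝ)| * D) ^ 4) e i k (by
    intro w h1 h2
    rw [fw_dd, le_div_iff₀ (by positivity)]
    have h3 : |j| * D ≤ |w| := by grind
    have h4 : |(j : ℝ)| * D ≤ |(w : ℝ)| := by exact_mod_cast h3
    have h5 := pow_le_pow_left₀ hX.le h4 4
    calc _ ≤ |g2 r t n w| * |(w : ℝ)| ^ 4 := by gcongr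
      _ ≤ C := by rw [mul_comm]; exact hC n w)
  refine this.trans ?_
  have h6 : ((i : ℝ) * k) ≤ 2 * |(j : ℝ)| ^ 2 := by
    have : ((i * k : ℕ) : ℝ) ≤ ((2 * j.natAbs ^ 2 : ℕ) : ℝ) := by exact_mod_cast hik
    push_cast at this
    rwa [Nat.cast_natAbs, Int.cast_abs] at this
  calc _ ≤ 2 * |(j : ℝ)| ^ 2 * (C / (|(j : ℝ)| * D) ^ 4) := by gcongr
    _ = _ := by
      rw [← sq_abs (j : ℝ)]
      field_simp

theorem GG_grad {r t : ℝ} (hr : 0 < r) (ht : 0 < t) (hrt : r + 2 * t = 1) :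
    ∃ C : ℝ, 0 < C ∧ ∀ (n : ℕ) (a b y : ℤ), a < b → a ≤ y → y + 1 ≤ b →
      |EE r t n (GI a b (y + 1)) - EE r t n (GI a b y)| ≤ C / ((b - a : ℤ) : ℝ) ^ 4 := by
  obtain ⟨C, hC0, hC⟩ := g2_bound hr ht hrt
  set Z := ∑' j : ℤ, 1 / (j : ℝ) ^ 2 with hZ
  have hZs : Summable (fun j : ℤ => 1 / (j : ℝ) ^ 2) := Real.summable_one_div_int_pow.2 (by norm_num)
  have hZ0 : 0 ≤ Z := tsum_nonneg (fun j => by positivity)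
  refine ⟨4 * C * Z + 1, by positivity, ?_⟩
  intro n a b y hab hay hyb
  have hDr : (0 : ℝ) < ((b - a : ℤ) : ℝ) := by exact_mod_cast (by omega)
  by_cases h0 : a ≤ 0 ∧ 0 ≤ b
  swap
  · have hz : ∀ y, EE r t n (GI a b y) = 0 := by
      intro y
      rw [EE_congr hr ht n _ 0, map_zero]
      intro s hs
      simp only [GI, Rch] at *
      rw [if_neg]; rfl
      omega
    rw [hz, hz]; simp; positivity
  obtain ⟨ha, hb⟩ := h0
  have R : ∀ a' b' : ℤ, a ≤ a' → a' ≤ a + 1 → b - 1 ≤ b' → b' ≤ b →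
      EE r t n (KI a' b' (y + 1)) - EE r t n (KI a' b' y) =
      ∑' j : ℤ, fw r t n (y + 2 * j * (b' - a' + 2)) +
      ∑' j : ℤ, fw r t n (2 * b' + 1 - y + 2 * j * (b' - a' + 2)) := by
    intro a' b' h1 h2 h3 h4
    have hL : 1 ≤ b' - a' + 2 := by omega
    rw [KK_refl hr ht n a' b' (by omega) (by omega) hL _ (by omega) (by omega),
      KK_refl hr ht n a' b' (by omega) (by omega) hL _ (by omega) (by omega)]
    unfold th fw
    have s := fun z => th_summable r t n (b' - a' + 2) z hL
    have s1 : Summable (fun j : ℤ => pw r t n (y + 2 * j * (b' - a' + 2) + 1)) := by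
      refine (s (y + 1)).congr (fun j => ?_); congr 1; ring
    have s2 : Summable (fun j : ℤ => pw r t n (2 * b' + 1 - y + 2 * j * (b' - a' + 2) + 1)) := by
      refine (s (2 * b' + 1 - y + 1)).congr (fun j => ?_); congr 1; ring
    rw [Summable.tsum_sub s1 (s _), Summable.tsum_sub s2 (s _)]
    have e1 : ∀ j : ℤ, y + 1 + 2 * j * (b' - a' + 2) = y + 2 * j * (b' - a' + 2) + 1 := by
      intro j; ring
    have e2 : ∀ j : ℤ, 2 * (b' + 1) - y + 2 * j * (b' - a' + 2) =
        2 * b' + 1 - y + 2 * j * (b' - a' + 2) + 1 := by intro j; ring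
    have e3 : 2 * (b' + 1) - (y + 1) = 2 * b' + 1 - y := by ring
    simp only [e1, e2, e3]
    ring
  have S : ∀ (L z : ℤ), 1 ≤ L → Summable (fun j : ℤ => fw r t n (z + 2 * j * L)) := by
    intro L z hL
    unfold fw
    refine Summable.sub ?_ (th_summable r t n L z hL)
    refine (th_summable r t n L (z + 1) hL).congr (fun j => ?_); congr 1; ring
  set D := b - a with hD
  have hD1 : 1 ≤ D := by omega
  have main : EE r t n (GI a b (y + 1)) - EE r t n (GI a b y) =
      (∑' j : ℤ, (fw r t n (y + 2 * j * (D + 2)) - fw r t n (y + 2 * j * (D + 1))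
        - fw r t n (y + 2 * j * (D + 1)) + fw r t n (y + 2 * j * D))) +
      (∑' j : ℤ, (fw r t n (2 * b + 1 - y + 2 * j * (D + 2)) - fw r t n (2 * b + 1 - y + 2 * j * (D + 1))
        - fw r t n (2 * b - 1 - y + 2 * j * (D + 1)) + fw r t n (2 * b - 1 - y + 2 * j * D))) := by
    have A1 := S (D + 2) y (by omega)
    have A2 := S (D + 1) y (by omega)
    have A3 := S D y (by omega)
    have B1 := S (D + 2) (2 * b + 1 - y) (by omega)
    have B2 := S (D + 1) (2 * b + 1 - y) (by omega)
    have B3 := S (D + 1) (2 * b - 1 - y) (by omega)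
    have B4 := S D (2 * b - 1 - y) (by omega)
    rw [Summable.tsum_add ((A1.sub A2).sub A2) A3, Summable.tsum_sub (A1.sub A2) A2,
      Summable.tsum_sub A1 A2,
      Summable.tsum_add ((B1.sub B2).sub B3) B4, Summable.tsum_sub (B1.sub B2) B3,
      Summable.tsum_sub B1 B2]
    rw [GI_eq, GI_eq]
    simp only [map_add, map_sub]
    have R1 := R a b (by omega) (by omega) (by omega) (by omega)
    have R2 := R (a + 1) b (by omega) (by omega) (by omega) (by omega)
    have R3 := R a (b - 1) (by omega) (by omega) (by omega) (by omega)
    have R4 := R (a + 1) (b - 1) (by omega) (by omega) (by omega) (by omega)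
    rw [show b - a + 2 = D + 2 by omega] at R1
    rw [show b - (a + 1) + 2 = D + 1 by omega] at R2
    rw [show b - 1 - a + 2 = D + 1 by omega, show 2 * (b - 1) + 1 - y = 2 * b - 1 - y by ring] at R3
    rw [show b - 1 - (a + 1) + 2 = D by omega, show 2 * (b - 1) + 1 - y = 2 * b - 1 - y by ring] at R4
    linarith
  have hsum : HasSum (fun j : ℤ => (2 * C / (D : ℝ) ^ 4) * (1 / (j : ℝ) ^ 2))
      ((2 * C / (D : ℝ) ^ 4) * Z) := hZs.hasSum.mul_left _
  have T1 : ∀ j : ℤ, ‖fw r t n (y + 2 * j * (D + 2)) - fw r t n (y + 2 * j * (D + 1))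
        - fw r t n (y + 2 * j * (D + 1)) + fw r t n (y + 2 * j * D)‖ ≤
        (2 * C / (D : ℝ) ^ 4) * (1 / (j : ℝ) ^ 2) := by
    intro j
    rw [Real.norm_eq_abs]
    rcases lt_trichotomy j 0 with hj | hj | hj
    · obtain ⟨i, rfl⟩ : ∃ i : ℕ, j = -(i : ℤ) := ⟨j.natAbs, by omega⟩
      have := fw_bound hC hC0 n (y + 2 * (-(i : ℤ)) * (D + 2)) i i (-(i : ℤ)) D hD1 (by omega)
        (by simp; nlinarith) (by
          intro h1 _
          right
          rw [abs_neg, Nat.abs_cast]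
          have : (1 : ℤ) ≤ i := by omega
          nlinarith)
      rw [show y + 2 * (-(i : ℤ)) * (D + 2) + 2 * i = y + 2 * (-(i : ℤ)) * (D + 1) by ring,
        show y + 2 * (-(i : ℤ)) * (D + 1) + 2 * i = y + 2 * (-(i : ℤ)) * D by ring] at this
      exact this
    · subst hj; simp
    · obtain ⟨i, rfl⟩ : ∃ i : ℕ, j = (i : ℤ) := ⟨j.natAbs, by omega⟩
      have := fw_bound hC hC0 n (y + 2 * (i : ℤ) * D) i i (i : ℤ) D hD1 (by omega)
        (by simp; nlinarith) (by
          intro h1 _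
          left
          rw [Nat.abs_cast]
          have : (1 : ℤ) ≤ i := by omega
          nlinarith)
      rw [show y + 2 * (i : ℤ) * D + 2 * i = y + 2 * (i : ℤ) * (D + 1) by ring,
        show y + 2 * (i : ℤ) * (D + 1) + 2 * i = y + 2 * (i : ℤ) * (D + 2) by ring] at this
      refine le_trans (le_of_eq ?_) this
      congr 1; ring
  have T2 : ∀ j : ℤ, ‖fw r t n (2 * b + 1 - y + 2 * j * (D + 2))
        - fw r t n (2 * b + 1 - y + 2 * j * (D + 1))
        - fw r t n (2 * b - 1 - y + 2 * j * (D + 1)) + fw r t n (2 * b - 1 - y + 2 * j * D)‖ ≤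
        (2 * C / (D : ℝ) ^ 4) * (1 / (j : ℝ) ^ 2) := by
    intro j
    rw [Real.norm_eq_abs]
    rcases lt_trichotomy j 0 with hj | hj | hj
    · obtain ⟨i, rfl⟩ : ∃ i : ℕ, j = -((i : ℤ) + 1) := ⟨j.natAbs - 1, by omega⟩
      have := fw_bound hC hC0 n (2 * b + 1 - y + 2 * (-((i : ℤ) + 1)) * (D + 2)) (i + 1) i
        (-((i : ℤ) + 1)) D hD1 (by omega)
        (by
          have : (-((i : ℤ) + 1)).natAbs = i + 1 := by omega
          rw [this]; nlinarith) (by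
          intro _ h1
          right
          have : (1 : ℤ) ≤ i := by omega
          rw [abs_neg, abs_of_nonneg (by omega)]
          push_cast
          nlinarith)
      push_cast at this
      rw [show 2 * b + 1 - y + 2 * (-((i : ℤ) + 1)) * (D + 2) + 2 * (i + 1) =
          2 * b + 1 - y + 2 * (-((i : ℤ) + 1)) * (D + 1) by ring,
        show 2 * b + 1 - y + 2 * (-((i : ℤ) + 1)) * (D + 2) + 2 * i =
          2 * b - 1 - y + 2 * (-((i : ℤ) + 1)) * (D + 1) by ring,
        show 2 * b + 1 - y + 2 * (-((i : ℤ) + 1)) * (D + 1) + 2 * i =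
          2 * b - 1 - y + 2 * (-((i : ℤ) + 1)) * D by ring] at this
      push_cast
      exact this
    · subst hj; simp
    · obtain ⟨i, rfl⟩ : ∃ i : ℕ, j = (i : ℤ) := ⟨j.natAbs, by omega⟩
      have := fw_bound hC hC0 n (2 * b - 1 - y + 2 * (i : ℤ) * D) i (i + 1) (i : ℤ) D hD1 (by omega)
        (by simp; nlinarith) (by
          intro h1 _
          left
          rw [Nat.abs_cast]
          have : (1 : ℤ) ≤ i := by omega
          nlinarith)
      push_cast at this
      rw [show 2 * b - 1 - y + 2 * (i : ℤ) * D + 2 * i = 2 * b - 1 - y + 2 * (i : ℤ) * (D + 1) by ring,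
        show 2 * b - 1 - y + 2 * (i : ℤ) * D + 2 * (i + 1) = 2 * b + 1 - y + 2 * (i : ℤ) * (D + 1) by ring,
        show 2 * b - 1 - y + 2 * (i : ℤ) * (D + 1) + 2 * (i + 1) =
          2 * b + 1 - y + 2 * (i : ℤ) * (D + 2) by ring] at this
      refine le_trans (le_of_eq ?_) this
      congr 1; ring
  have U1 := tsum_of_norm_bounded hsum T1
  have U2 := tsum_of_norm_bounded hsum T2
  rw [Real.norm_eq_abs] at U1 U2
  rw [main]
  refine (abs_add_le _ _).trans ?_
  calc _ ≤ (2 * C / (D : ℝ) ^ 4) * Z + (2 * C / (D : ℝ) ^ 4) * Z := add_le_add U1 U2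
    _ = 4 * C * Z / (D : ℝ) ^ 4 := by ring
    _ ≤ _ := by gcongr; linarith

/-- position of a wreath element -/
def wpos {F : Type*} [Group F] (h : Wreath ℤ F) : ℤ := Multiplicative.toAdd h.right

/-- lamp configuration of a wreath element -/
def wlamp {F : Type*} [Group F] (h : Wreath ℤ F) : ℤ → F := h.left.1

theorem wlamp_mul {F : Type*} [Group F] (g h : Wreath ℤ F) (z : ℤ) :
    wlamp (g * h) z = wlamp g z * wlamp h (z - wpos g) := rfl

theorem wpos_mul {F : Type*} [Group F] (g h : Wreath ℤ F) : wpos (g * h) = wpos g + wpos h := rfl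

theorem w_ext {F : Type*} [Group F] (g h : Wreath ℤ F) (h1 : wlamp g = wlamp h) (h2 : wpos g = wpos h) :
    g = h := by
  apply SemidirectProduct.ext
  · exact Subtype.ext h1
  · exact h2

theorem deltaF_apply {F : Type*} [Group F] (f : F) (z : ℤ) :
    (deltaF f : FinMulSupp ℤ F).1 z = if z = 0 then f else 1 := by
  unfold deltaF
  by_cases hz : z = 0 <;> simp [hz]

theorem wlamp_inl {F : Type*} [Group F] (f : F) (z : ℤ) :
    wlamp (SemidirectProduct.inl (deltaF f) : Wreath ℤ F) z = if z = 0 then f else 1 :=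
  deltaF_apply f z

theorem wpos_inl {F : Type*} [Group F] (f : F) :
    wpos (SemidirectProduct.inl (deltaF f) : Wreath ℤ F) = 0 := rfl

theorem wlamp_inr {F : Type*} [Group F] (d : ℤ) (z : ℤ) :
    wlamp (SemidirectProduct.inr (Multiplicative.ofAdd d) : Wreath ℤ F) z = 1 := rfl

theorem wpos_inr {F : Type*} [Group F] (d : ℤ) :
    wpos (SemidirectProduct.inr (Multiplicative.ofAdd d) : Wreath ℤ F) = d := rfl

theorem inl_delta_inv {F : Type*} [Group F] (f : F) :
    (SemidirectProduct.inl (deltaF f) : Wreath ℤ F)⁻¹ = SemidirectProduct.inl (deltaF f⁻¹) := by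
  rw [← map_inv]
  congr 1
  apply Subtype.ext
  funext x
  change ((deltaF f : FinMulSupp ℤ F).1 x)⁻¹ = (deltaF f⁻¹ : FinMulSupp ℤ F).1 x
  rw [deltaF_apply, deltaF_apply]
  split_ifs <;> simp

theorem inl_delta_mul {F : Type*} [Group F] (f g : F) :
    (SemidirectProduct.inl (deltaF f) : Wreath ℤ F) * SemidirectProduct.inl (deltaF g) =
      SemidirectProduct.inl (deltaF (f * g)) := by
  rw [← map_mul]
  congr 1
  apply Subtype.ext
  funext x
  change (deltaF f : FinMulSupp ℤ F).1 x * (deltaF g : FinMulSupp ℤ F).1 x = (deltaF (f * g) : FinMulSupp ℤ F).1 x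
  rw [deltaF_apply, deltaF_apply, deltaF_apply]
  split_ifs <;> simp

theorem inr_inv' {F : Type*} [Group F] (d : ℤ) :
    (SemidirectProduct.inr (Multiplicative.ofAdd d) : Wreath ℤ F)⁻¹ =
      SemidirectProduct.inr (Multiplicative.ofAdd (-d)) := by
  rw [← map_inv]; rfl

theorem conv_coeff {G : Type*} [Group G] (x y : MonoidAlgebra ℝ G) :
    conv (fun g => x.coeff g) (fun g => y.coeff g) = fun g => (x * y).coeff g := by
  funext g
  rw [MonoidAlgebra.coeff_mul_apply_left]
  unfold conv
  rw [tsum_eq_sum (s := x.coeff.support)]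
  · rfl
  · intro b hb
    simp only [Finsupp.notMem_support_iff.mp hb, zero_mul]

theorem convPow_coeff {G : Type*} [Group G] (x : MonoidAlgebra ℝ G) (n : ℕ) :
    convPow (fun g => x.coeff g) n = fun g => (x ^ n).coeff g := by
  induction n with
  | zero =>
    funext g
    rw [pow_zero, MonoidAlgebra.one_def, MonoidAlgebra.coeff_single, Finsupp.single_apply]
    simp only [convPow, eq_comm]
  | succ n ih =>
    rw [convPow, ih, conv_coeff, pow_succ']

def UU (F : Type*) [Group F] [Fintype F] : MonoidAlgebra ℝ (Wreath ℤ F) :=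
  ∑ f : F, MonoidAlgebra.single (SemidirectProduct.inl (deltaF f)) (Fintype.card F : ℝ)⁻¹

def AA (F : Type*) [Group F] (r t : ℝ) : MonoidAlgebra ℝ (Wreath ℤ F) :=
  MonoidAlgebra.single (SemidirectProduct.inr (Multiplicative.ofAdd 0)) r +
  MonoidAlgebra.single (SemidirectProduct.inr (Multiplicative.ofAdd 1)) t +
  MonoidAlgebra.single (SemidirectProduct.inr (Multiplicative.ofAdd (-1))) t

theorem inl_delta_inj {F : Type*} [Group F] {f g : F}
    (h : (SemidirectProduct.inl (deltaF f) : Wreath ℤ F) = SemidirectProduct.inl (deltaF g)) : f = g := by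
  have := congrArg (fun w => wlamp w 0) h
  simpa [wlamp_inl] using this

theorem UU_coeff (F : Type*) [Group F] [Fintype F] :
    unifF ℤ F = fun g => (UU F).coeff g := by
  funext g
  unfold unifF UU
  rw [MonoidAlgebra.coeff_sum, Finsupp.finsetSum_apply]
  by_cases hg : ∃ f : F, g = SemidirectProduct.inl (deltaF f)
  · rw [Set.indicator_of_mem (by exact hg)]
    obtain ⟨f, rfl⟩ := hg
    rw [Finset.sum_eq_single f]
    · simp
    · intro b _ hb
      rw [MonoidAlgebra.coeff_single, Finsupp.single_apply, if_neg]
      intro h; exact hb (inl_delta_inj h)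
    · simp
  · rw [Set.indicator_of_notMem (by exact hg)]
    symm
    apply Finset.sum_eq_zero
    intro f _
    rw [MonoidAlgebra.coeff_single, Finsupp.single_apply, if_neg]
    intro h; exact hg ⟨f, h.symm⟩

theorem AA_coeff (F : Type*) [Group F] (ν : ℤ → ℝ)
    (hνsym : ∀ z : ℤ, ν z = ν (-z))
    (hνsupp : Function.support ν = {-1, 0, 1}) :
    (liftA ν : Wreath ℤ F → ℝ) = fun g => (AA F (ν 0) (ν 1)).coeff g := by
  funext g
  unfold liftA AA
  simp only [MonoidAlgebra.coeff_add, MonoidAlgebra.coeff_single, Finsupp.add_apply, Finsupp.single_apply]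
  by_cases hg : g.left = 1
  · rw [if_pos hg]
    have key : ∀ d : ℤ, (SemidirectProduct.inr (Multiplicative.ofAdd d) = g) ↔ wpos g = d := by
      intro d
      constructor
      · rintro rfl; rfl
      · intro h
        apply SemidirectProduct.ext
        · rw [hg]; rfl
        · exact h.symm
    simp only [key]
    change ν (wpos g) = _
    generalize wpos g = z
    by_cases h0 : z = 0
    · subst h0; simp
    by_cases h1 : z = 1
    · subst h1; simp
    by_cases h2 : z = -1
    · subst h2; simp [hνsym (-1)]
    have : z ∉ Function.support ν := by rw [hνsupp]; simp [h0, h1, h2]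
    simp [h0, h1, h2]
    simpa using this
  · rw [if_neg hg]
    have key : ∀ d : ℤ, (SemidirectProduct.inr (Multiplicative.ofAdd d) = g) ↔ False := by
      intro d
      simp only [iff_false]
      rintro rfl; exact hg rfl
    simp only [key, if_false, add_zero]

theorem UU_idem (F : Type*) [Group F] [Fintype F] : UU F * UU F = UU F := by
  unfold UU
  rw [Finset.sum_mul]
  simp only [Finset.mul_sum, MonoidAlgebra.single_mul_single, inl_delta_mul]
  have : ∀ f : F, ∑ g : F, MonoidAlgebra.single (SemidirectProduct.inl (deltaF (f * g)) : Wreath ℤ F)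
      ((Fintype.card F : ℝ)⁻¹ * (Fintype.card F : ℝ)⁻¹) =
      (Fintype.card F : ℝ)⁻¹ • ∑ g : F, MonoidAlgebra.single (SemidirectProduct.inl (deltaF g) : Wreath ℤ F)
      ((Fintype.card F : ℝ)⁻¹) := by
    intro f
    rw [Finset.smul_sum]
    refine (Equiv.sum_comp (Equiv.mulLeft f) (fun g => MonoidAlgebra.single (SemidirectProduct.inl (deltaF g) : Wreath ℤ F)
      ((Fintype.card F : ℝ)⁻¹ * (Fintype.card F : ℝ)⁻¹))).trans ?_
    simp [MonoidAlgebra.smul_single]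
  simp only [this]
  rw [Finset.sum_const, Finset.card_univ, ← Nat.cast_smul_eq_nsmul ℝ, smul_smul, mul_inv_cancel₀, one_smul]
  exact_mod_cast Fintype.card_ne_zero

def PP (F : Type*) [Group F] [Fintype F] (r t : ℝ) (n : ℕ) : MonoidAlgebra ℝ (Wreath ℤ F) :=
  (UU F * (AA F r t * UU F)) ^ n * UU F

theorem PP_zero (F : Type*) [Group F] [Fintype F] (r t : ℝ) : PP F r t 0 = UU F := by
  unfold PP; simp

theorem PP_succ (F : Type*) [Group F] [Fintype F] (r t : ℝ) (n : ℕ) :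
    PP F r t (n + 1) = PP F r t n * AA F r t * UU F := by
  unfold PP
  rw [pow_succ]
  simp only [mul_assoc, UU_idem]

theorem PP_eq (F : Type*) [Group F] [Fintype F] (r t : ℝ) (n : ℕ) :
    PP F r t (n + 1) = (UU F * (AA F r t * UU F)) ^ (n + 1) := by
  rw [PP_succ, PP, pow_succ]
  simp only [mul_assoc]

theorem convPow_eq (F : Type*) [Group F] [Fintype F] (ν : ℤ → ℝ)
    (hνsym : ∀ z : ℤ, ν z = ν (-z))
    (hνsupp : Function.support ν = {-1, 0, 1}) (n : ℕ) (hn : 1 ≤ n) (h : Wreath ℤ F) :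
    convPow (swsMeasure ν) n h = (PP F (ν 0) (ν 1) n).coeff h := by
  unfold swsMeasure
  rw [AA_coeff F ν hνsym hνsupp, UU_coeff, conv_coeff, conv_coeff, convPow_coeff]
  obtain ⟨k, rfl⟩ : ∃ k, n = k + 1 := ⟨n - 1, by omega⟩
  rw [PP_eq]

theorem PP_coeff_succ (F : Type*) [Group F] [Fintype F] (r t : ℝ) (n : ℕ) (h : Wreath ℤ F) :
    (PP F r t (n + 1)).coeff h = ∑ f : F, (Fintype.card F : ℝ)⁻¹ *
      (r * (PP F r t n).coeff (h * SemidirectProduct.inl (deltaF f⁻¹) * SemidirectProduct.inr (Multiplicative.ofAdd (-0)))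
      + t * ((PP F r t n).coeff (h * SemidirectProduct.inl (deltaF f⁻¹) * SemidirectProduct.inr (Multiplicative.ofAdd (-1)))
      + (PP F r t n).coeff (h * SemidirectProduct.inl (deltaF f⁻¹) * SemidirectProduct.inr (Multiplicative.ofAdd (- -1))))) := by
  rw [PP_succ]
  conv_lhs => rw [UU]
  rw [Finset.mul_sum, MonoidAlgebra.coeff_sum, Finsupp.finsetSum_apply]
  apply Finset.sum_congr rfl
  intro f _
  rw [MonoidAlgebra.coeff_mul_single_apply, AA, mul_add, mul_add, MonoidAlgebra.coeff_add, MonoidAlgebra.coeff_add,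
    Finsupp.add_apply, Finsupp.add_apply, MonoidAlgebra.coeff_mul_single_apply, MonoidAlgebra.coeff_mul_single_apply,
    MonoidAlgebra.coeff_mul_single_apply, inl_delta_inv, inr_inv', inr_inv', inr_inv']
  ring

/-- conditional probability of lamp configuration -/
def Fh {F : Type*} [Group F] [Fintype F] (φ : ℤ → F) (x : ℤ) (s : St) : ℝ :=
  if s.2.2 = x ∧ (∀ z, φ z ≠ 1 → s.1 ≤ z ∧ z ≤ s.2.1) then
    ((Fintype.card F : ℝ)⁻¹) ^ ((s.2.1 - s.1 + 1).toNat) else 0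

theorem Fh_mk {F : Type*} [Group F] [Fintype F] (φ : ℤ → F) (x a b w : ℤ) :
    Fh φ x (a, b, w) = if w = x ∧ (∀ z, φ z ≠ 1 → a ≤ z ∧ z ≤ b) then
    ((Fintype.card F : ℝ)⁻¹) ^ ((b - a + 1).toNat) else 0 := rfl

theorem Fh_step {F : Type*} [Group F] [Fintype F] (φ : ℤ → F) (x d : ℤ) (hd : -1 ≤ d) (hd' : d ≤ 1)
    (s : St) (h1 : s.1 ≤ s.2.2) (h2 : s.2.2 ≤ s.2.1) :
    Fh φ x (stp s d) = ∑ f : F, (Fintype.card F : ℝ)⁻¹ *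
      Fh (fun z => φ z * if z - x = 0 then f⁻¹ else 1) (x + -d) s := by
  obtain ⟨a, b, w⟩ := s
  simp only at h1 h2
  rw [show stp (a, b, w) d = (min a (w + d), max b (w + d), w + d) from rfl]
  simp only [Fh_mk]
  by_cases hw : w + d = x
  swap
  · rw [if_neg (fun h => hw h.1)]
    symm
    apply Finset.sum_eq_zero
    intro f _
    rw [if_neg, mul_zero]
    intro h; apply hw; have := h.1; omega
  have hw' : w = x + -d := by omega
  have hm : (Fintype.card F : ℝ) ≠ 0 := by exact_mod_cast Fintype.card_ne_zero
  by_cases hx : a ≤ x ∧ x ≤ b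
  · rw [hw, min_eq_left hx.1, max_eq_left hx.2]
    have : ∀ f : F, (∀ z, (φ z * if z - x = 0 then f⁻¹ else 1) ≠ 1 → a ≤ z ∧ z ≤ b) ↔
        (∀ z, φ z ≠ 1 → a ≤ z ∧ z ≤ b) := by
      intro f
      apply forall_congr'
      intro z
      by_cases hz : z - x = 0
      · have : z = x := by omega
        subst this
        simp [hx]
      · simp [hz]
    simp only [this, hw', true_and]
    rw [Finset.sum_const, Finset.card_univ, nsmul_eq_mul, ← mul_assoc, mul_inv_cancel₀ hm, one_mul]
  · rw [Finset.sum_eq_single (φ x)]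
    · have hlen : (max b (w + d) - min a (w + d) + 1).toNat = (b - a + 1).toNat + 1 := by omega
      rw [hlen, pow_succ']
      have : (∀ z, φ z ≠ 1 → min a (w + d) ≤ z ∧ z ≤ max b (w + d)) ↔
        (∀ z, (φ z * if z - x = 0 then (φ x)⁻¹ else 1) ≠ 1 → a ≤ z ∧ z ≤ b) := by
        apply forall_congr'
        intro z
        by_cases hz : z - x = 0
        · have : z = x := by omega
          subst this
          simp [hw]
        · simp only [hz, if_false, mul_one]
          have : (min a (w + d) ≤ z ∧ z ≤ max b (w + d)) ↔ (a ≤ z ∧ z ≤ b) := by omega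
          rw [this]
      by_cases hP : ∀ z, (φ z * if z - x = 0 then (φ x)⁻¹ else 1) ≠ 1 → a ≤ z ∧ z ≤ b
      · rw [if_pos ⟨hw, this.mpr hP⟩, if_pos ⟨hw', hP⟩]
      · rw [if_neg (fun h => hP (this.mp h.2)), if_neg (fun h => hP h.2), mul_zero]
    · intro f _ hf
      rw [if_neg, mul_zero]
      rintro ⟨_, h⟩
      apply hx
      apply h x
      simp only [sub_self, if_true]
      intro h3
      exact hf (mul_inv_eq_one.mp h3).symm
    · simp

theorem PP_formula (F : Type*) [Group F] [Fintype F] {r t : ℝ} (hr : 0 < r) (ht : 0 < t) (n : ℕ) (h : Wreath ℤ F) :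
    (PP F r t n).coeff h = EE r t n (Fh (wlamp h) (wpos h)) := by
  induction n generalizing h with
  | zero =>
    rw [PP_zero, EE_zero]
    have hU : unifF ℤ F h = (UU F).coeff h := congrFun (UU_coeff F) h
    rw [← hU]
    unfold unifF Fh
    rw [Set.indicator_apply]
    have : (h ∈ {g : Wreath ℤ F | ∃ f : F, g = SemidirectProduct.inl (deltaF f)}) ↔
      (0 = wpos h ∧ ∀ z, wlamp h z ≠ 1 → 0 ≤ z ∧ z ≤ 0) := by
      constructor
      · rintro ⟨f, rfl⟩
        refine ⟨rfl, ?_⟩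
        intro z hz
        rw [wlamp_inl] at hz
        by_contra hh
        apply hz
        rw [if_neg (by omega)]
      · rintro ⟨h1, h2⟩
        refine ⟨wlamp h 0, ?_⟩
        apply w_ext
        · funext z
          rw [wlamp_inl]
          split_ifs with hz
          · rw [hz]
          · by_contra hh
            have := h2 z hh
            omega
        · rw [wpos_inl]; exact h1.symm
    simp only [this]
    simp
  | succ n ih =>
    rw [PP_coeff_succ, EE_succ]
    simp only [ih]
    have e : ∀ f : F, ∀ d : ℤ, EE r t n (Fh (wlamp (h * SemidirectProduct.inl (deltaF f⁻¹) * SemidirectProduct.inr (Multiplicative.ofAdd (-d))))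
      (wpos (h * SemidirectProduct.inl (deltaF f⁻¹) * SemidirectProduct.inr (Multiplicative.ofAdd (-d))))) =
      EE r t n (Fh (fun z => wlamp h z * if z - wpos h = 0 then f⁻¹ else 1) (wpos h + -d)) := by
      intro f d
      congr 2
      · funext z
        rw [wlamp_mul, wlamp_mul, wlamp_inr, wlamp_inl, mul_one]
      · rw [wpos_mul, wpos_mul, wpos_inr, wpos_inl, add_zero]
    simp only [e]
    have e2 : ∀ (c : ℝ) (G : St → ℝ), c * EE r t n G = EE r t n (c • G) := by
      intro c G; rw [map_smul, smul_eq_mul]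
    simp only [e2, ← map_add, ← map_sum]
    apply EE_congr hr ht
    intro s hs
    rw [TT_apply, Fh_step _ _ 0 (by norm_num) (by norm_num) s hs.2.2.1 hs.2.2.2.1,
      Fh_step _ _ 1 (by norm_num) (by norm_num) s hs.2.2.1 hs.2.2.2.1,
      Fh_step _ _ (-1) (by norm_num) (by norm_num) s hs.2.2.1 hs.2.2.2.1]
    simp only [Finset.sum_apply, Pi.smul_apply, Pi.add_apply, smul_eq_mul, Finset.mul_sum, ← Finset.sum_add_distrib]
    apply Finset.sum_congr rfl
    intro f _
    ring

theorem gen_cases {F : Type*} [Group F] (x : Wreath ℤ F) (hx : x ∈ stdGenZ F ∨ x⁻¹ ∈ stdGenZ F) :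
    (∃ d : ℤ, |d| ≤ 1 ∧ x = SemidirectProduct.inr (Multiplicative.ofAdd d)) ∨
    ∃ f : F, x = SemidirectProduct.inl (deltaF f) := by
  rcases hx with ((h | h) | ⟨f, h⟩) | ((h | h) | ⟨f, h⟩)
  · exact Or.inl ⟨1, by norm_num, h⟩
  · exact Or.inl ⟨-1, by norm_num, h⟩
  · exact Or.inr ⟨f, h⟩
  · refine Or.inl ⟨-1, by norm_num, ?_⟩
    rw [← inr_inv', ← h, inv_inv]
  · refine Or.inl ⟨1, by norm_num, ?_⟩
    rw [inv_eq_iff_eq_inv, inr_inv'] at h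
    rw [h]; rfl
  · refine Or.inr ⟨f⁻¹, ?_⟩
    rw [← inl_delta_inv, ← h, inv_inv]

theorem list_bound {F : Type*} [Group F] (l : List (Wreath ℤ F))
    (hl : ∀ x ∈ l, x ∈ stdGenZ F ∨ x⁻¹ ∈ stdGenZ F) :
    |wpos l.prod| ≤ l.length ∧ ∀ z, wlamp l.prod z ≠ 1 → |z| ≤ l.length := by
  induction l with
  | nil =>
    refine ⟨?_, ?_⟩
    · simp [wpos]
    · intro z hz; exact absurd rfl hz
  | cons x l ih =>
    obtain ⟨h1, h2⟩ := ih (fun y hy => hl y (List.mem_cons_of_mem _ hy))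
    rw [List.prod_cons, List.length_cons]
    push_cast
    rcases gen_cases x (hl x List.mem_cons_self) with ⟨d, hd, rfl⟩ | ⟨f, rfl⟩
    · refine ⟨?_, ?_⟩
      · rw [wpos_mul, wpos_inr]
        have := abs_add_le d (wpos l.prod)
        omega
      · intro z hz
        rw [wlamp_mul, wlamp_inr, one_mul, wpos_inr] at hz
        have := h2 _ hz
        have := abs_add_le d (z - d)
        rw [show d + (z - d) = z by ring] at this
        omega
    · refine ⟨?_, ?_⟩
      · rw [wpos_mul, wpos_inl, zero_add]; omega
      · intro z hz
        rw [wlamp_mul, wlamp_inl, wpos_inl, sub_zero] at hz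
        by_cases hz0 : z = 0
        · subst hz0; simp; omega
        · rw [if_neg hz0, one_mul] at hz
          have := h2 _ hz
          omega

theorem inr_mem {F : Type*} [Group F] (d : ℤ) :
    (SemidirectProduct.inr (Multiplicative.ofAdd d) : Wreath ℤ F) ∈ Subgroup.closure (stdGenZ F) := by
  have h1 : (SemidirectProduct.inr (Multiplicative.ofAdd 1) : Wreath ℤ F) ∈ Subgroup.closure (stdGenZ F) :=
    Subgroup.subset_closure (Or.inl (Or.inl rfl))
  have := Subgroup.zpow_mem _ h1 d
  rw [← map_zpow, ← ofAdd_zsmul] at this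
  simpa using this

theorem all_mem {F : Type*} [Group F] (s : Finset ℤ) : ∀ (g : Wreath ℤ F)
    (_ : ∀ z, wlamp g z ≠ 1 → z ∈ s), g ∈ Subgroup.closure (stdGenZ F) := by
  induction s using Finset.induction_on with
  | empty =>
    intro g hg
    have : g = SemidirectProduct.inr (Multiplicative.ofAdd (wpos g)) := by
      apply w_ext
      · funext z
        rw [wlamp_inr]
        by_contra h
        simpa using hg z h
      · rfl
    rw [this]
    exact inr_mem _
  | insert a s ha ih =>
    intro g hg
    have hk : (SemidirectProduct.inr (Multiplicative.ofAdd a) * SemidirectProduct.inl (deltaF (wlamp g a)⁻¹)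
      * SemidirectProduct.inr (Multiplicative.ofAdd (-a)) : Wreath ℤ F) ∈ Subgroup.closure (stdGenZ F) :=
      mul_mem (mul_mem (inr_mem _) (Subgroup.subset_closure (Or.inr ⟨_, rfl⟩))) (inr_mem _)
    rw [← Subgroup.mul_mem_cancel_left _ hk]
    apply ih
    intro z hz
    rw [wlamp_mul, wlamp_mul, wlamp_mul, wpos_mul, wpos_mul, wpos_mul, wlamp_inr, wlamp_inr, wlamp_inl, wpos_inr, wpos_inr,
      wpos_inl, one_mul, mul_one, show z - (a + 0 + -a) = z by ring] at hz
    by_cases hza : z = a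
    · subst hza; simp at hz
    · rw [if_neg (by omega), one_mul] at hz
      exact (Finset.mem_insert.mp (hg z hz)).resolve_left hza

theorem wl_bound {F : Type*} [Group F] (g : Wreath ℤ F) :
    |wpos g| ≤ wordLength (stdGenZ F) g ∧ ∀ z, wlamp g z ≠ 1 → |z| ≤ wordLength (stdGenZ F) g := by
  have hne : {k | ∃ l : List (Wreath ℤ F), l.length = k ∧
      (∀ x ∈ l, x ∈ stdGenZ F ∨ x⁻¹ ∈ stdGenZ F) ∧ l.prod = g}.Nonempty := by
    have hg : g ∈ Subgroup.closure (stdGenZ F) := by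
      apply all_mem g.left.2.toFinset
      intro z hz
      exact (Set.Finite.mem_toFinset _).mpr hz
    rw [← Subgroup.mem_toSubmonoid, Subgroup.closure_toSubmonoid] at hg
    obtain ⟨l, h1, h2⟩ := Submonoid.exists_list_of_mem_closure hg
    exact ⟨l.length, l, rfl, fun x hx => h1 x hx, h2⟩
  obtain ⟨l, h1, h2, h3⟩ := Nat.sInf_mem hne
  have := list_bound l h2
  rw [h1, h3] at this
  exact this

/-- convex hull of the lamp support -/
def Hull {F : Type*} [Group F] (φ : ℤ → F) (p q : ℤ) : Prop :=
  φ p ≠ 1 ∧ φ q ≠ 1 ∧ ∀ z, φ z ≠ 1 → p ≤ z ∧ z ≤ q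

/-- the formula for the probability of an element with hull `[p,q]` and position `x` -/
def QQ (r t m : ℝ) (n : ℕ) (p q x : ℤ) : ℝ :=
  ∑ a ∈ Finset.Icc (-(n : ℤ)) p, ∑ b ∈ Finset.Icc q (n : ℤ), m⁻¹ ^ ((b - a + 1).toNat) * EE r t n (GI a b x)

theorem PP_hull (F : Type*) [Group F] [Fintype F] {r t : ℝ} (hr : 0 < r) (ht : 0 < t) (n : ℕ) (h : Wreath ℤ F)
    (p q : ℤ) (hh : Hull (wlamp h) p q) :
    (PP F r t n).coeff h = QQ r t (Fintype.card F) n p q (wpos h) := by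
  rw [PP_formula F hr ht, QQ]
  have e2 : ∀ (c : ℝ) (G : St → ℝ), c * EE r t n G = EE r t n (c • G) := by
    intro c G; rw [map_smul, smul_eq_mul]
  simp only [e2, ← map_sum]
  apply EE_congr hr ht
  intro s hs
  obtain ⟨a, b, w⟩ := s
  simp only [Rch] at hs
  simp only [Finset.sum_apply, Pi.smul_apply, smul_eq_mul, GI]
  rw [Fh_mk]
  by_cases hP : w = wpos h ∧ (∀ z, wlamp h z ≠ 1 → a ≤ z ∧ z ≤ b)
  · rw [if_pos hP]
    have h1 := hP.2 p hh.1
    have h2 := hP.2 q hh.2.1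
    rw [Finset.sum_eq_single a, Finset.sum_eq_single b]
    · rw [if_pos ⟨rfl, rfl, hP.1⟩, mul_one]
    · intro b' _ hb'
      rw [if_neg (fun h => hb' h.2.1.symm), mul_zero]
    · intro hb'
      exfalso; apply hb'; rw [Finset.mem_Icc]; omega
    · intro a' _ ha'
      apply Finset.sum_eq_zero
      intro b' _
      rw [if_neg (fun h => ha' h.1.symm), mul_zero]
    · intro hb'
      exfalso; apply hb'; rw [Finset.mem_Icc]; omega
  · rw [if_neg hP]
    symm
    apply Finset.sum_eq_zero
    intro a' ha'
    apply Finset.sum_eq_zero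
    intro b' hb'
    rw [if_neg, mul_zero]
    rintro ⟨rfl, rfl, h3⟩
    apply hP
    refine ⟨h3, fun z hz => ?_⟩
    have := hh.2.2 z hz
    rw [Finset.mem_Icc] at ha' hb'
    omega

theorem geo_two_le {u : ℝ} (hu : 0 ≤ u) (hu2 : u ≤ 1 / 2) (s : Finset ℤ) (g : ℤ → ℕ) (hg : Set.InjOn g s) :
    ∑ a ∈ s, u ^ g a ≤ 2 := by
  calc ∑ a ∈ s, u ^ g a ≤ ∑ a ∈ s, (1 / 2 : ℝ) ^ g a :=
        Finset.sum_le_sum fun a _ => pow_le_pow_left₀ hu hu2 _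
    _ = ∑ i ∈ s.image g, (1 / 2 : ℝ) ^ i := (Finset.sum_image (fun x hx y hy h => hg hx hy h)).symm
    _ ≤ ∑' i : ℕ, (1 / 2 : ℝ) ^ i := Summable.sum_le_tsum _ (fun i _ => by positivity) summable_geometric_two
    _ = 2 := tsum_geometric_two

theorem QQ_grad {r t : ℝ} (hr : 0 < r) (ht : 0 < t) (hrt : r + 2 * t = 1) (m : ℝ) (hm : 2 ≤ m) :
    ∃ C > 0, ∀ (n : ℕ) (p q y : ℤ), p < q → p ≤ y → y + 1 ≤ q →
      |QQ r t m n p q (y + 1) - QQ r t m n p q y| ≤ C * m⁻¹ ^ ((q - p + 1).toNat) / ((q - p : ℤ) : ℝ) ^ 4 := by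
  obtain ⟨C, hC, hG⟩ := GG_grad hr ht hrt
  refine ⟨4 * C, by positivity, ?_⟩
  intro n p q y hpq hpy hyq
  have hu : 0 ≤ m⁻¹ := by positivity
  have hu2 : m⁻¹ ≤ 1 / 2 := by
    rw [inv_eq_one_div]; exact one_div_le_one_div_of_le (by norm_num) hm
  unfold QQ
  rw [← Finset.sum_sub_distrib]
  simp only [← Finset.sum_sub_distrib, ← mul_sub]
  have hpos : (0 : ℝ) < ((q - p : ℤ) : ℝ) := by exact_mod_cast (by omega : (0 : ℤ) < q - p)
  calc _ ≤ ∑ a ∈ Finset.Icc (-(n : ℤ)) p, ∑ b ∈ Finset.Icc q (n : ℤ),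
        (m⁻¹ ^ ((p - a).toNat) * m⁻¹ ^ ((b - q).toNat)) * (C * m⁻¹ ^ ((q - p + 1).toNat) / ((q - p : ℤ) : ℝ) ^ 4) := by
        refine (Finset.abs_sum_le_sum_abs _ _).trans (Finset.sum_le_sum fun a ha => ?_)
        refine (Finset.abs_sum_le_sum_abs _ _).trans (Finset.sum_le_sum fun b hb => ?_)
        rw [Finset.mem_Icc] at ha hb
        rw [abs_mul, abs_of_nonneg (by positivity)]
        have e : (b - a + 1).toNat = (p - a).toNat + (b - q).toNat + (q - p + 1).toNat := by omega
        rw [e, pow_add, pow_add]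
        have h1 := hG n a b y (by omega) (by omega) (by omega)
        have h2 : C / ((b - a : ℤ) : ℝ) ^ 4 ≤ C / ((q - p : ℤ) : ℝ) ^ 4 := by
          have : ((q - p : ℤ) : ℝ) ≤ ((b - a : ℤ) : ℝ) := by exact_mod_cast (by omega)
          gcongr
        calc _ ≤ m⁻¹ ^ (p - a).toNat * m⁻¹ ^ (b - q).toNat * m⁻¹ ^ (q - p + 1).toNat * (C / ((q - p : ℤ) : ℝ) ^ 4) := by
              apply mul_le_mul_of_nonneg_left (h1.trans h2); positivity
          _ = _ := by ring
    _ = (∑ a ∈ Finset.Icc (-(n : ℤ)) p, m⁻¹ ^ ((p - a).toNat)) * (∑ b ∈ Finset.Icc q (n : ℤ), m⁻¹ ^ ((b - q).toNat)) *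
        (C * m⁻¹ ^ ((q - p + 1).toNat) / ((q - p : ℤ) : ℝ) ^ 4) := by
        simp only [← Finset.sum_mul, ← Finset.mul_sum]
    _ ≤ 2 * 2 * (C * m⁻¹ ^ ((q - p + 1).toNat) / ((q - p : ℤ) : ℝ) ^ 4) := by
        have h1 : ∑ a ∈ Finset.Icc (-(n : ℤ)) p, m⁻¹ ^ ((p - a).toNat) ≤ 2 := by
          apply geo_two_le hu hu2 _ (fun a => (p - a).toNat)
          intro x hx y hy h
          simp only [Finset.coe_Icc, Set.mem_Icc] at hx hy h
          omega
        have h2 : ∑ b ∈ Finset.Icc q (n : ℤ), m⁻¹ ^ ((b - q).toNat) ≤ 2 := by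
          apply geo_two_le hu hu2 _ (fun b => (b - q).toNat)
          intro x hx y hy h
          simp only [Finset.coe_Icc, Set.mem_Icc] at hx hy h
          omega
        apply mul_le_mul_of_nonneg_right _ (by positivity)
        exact mul_le_mul h1 h2 (Finset.sum_nonneg fun _ _ => by positivity) (by norm_num)
    _ = _ := by ring

theorem lip_of_step (f : ℤ → ℝ) (p q : ℤ) (D : ℝ)
    (h : ∀ y, p ≤ y → y + 1 ≤ q → |f (y + 1) - f y| ≤ D) (x : ℤ) (k : ℕ) (hx : p ≤ x) (hk : x + k ≤ q) :
    |f (x + k) - f x| ≤ k * D := by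
  induction k with
  | zero => simp
  | succ k ih =>
    push_cast at hk ⊢
    have h1 := ih (by omega)
    have h2 := h (x + k) (by omega) (by omega)
    rw [show x + ((k : ℤ) + 1) = x + k + 1 by ring]
    have := abs_sub_le (f (x + k + 1)) (f (x + k)) (f x)
    linarith

theorem lip_of_step' (f : ℤ → ℝ) (p q : ℤ) (D : ℝ)
    (h : ∀ y, p ≤ y → y + 1 ≤ q → |f (y + 1) - f y| ≤ D) (x y : ℤ) (hx : p ≤ x) (hx' : x ≤ q)
    (hy : p ≤ y) (hy' : y ≤ q) :
    |f y - f x| ≤ |((y - x : ℤ) : ℝ)| * D := by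
  rcases le_total x y with hxy | hxy
  · obtain ⟨k, hk⟩ := Int.eq_ofNat_of_zero_le (sub_nonneg.mpr hxy)
    have : y = x + k := by omega
    subst this
    have := lip_of_step f p q D h x k hx hy'
    simpa using this
  · obtain ⟨k, hk⟩ := Int.eq_ofNat_of_zero_le (sub_nonneg.mpr hxy)
    have : x = y + k := by omega
    subst this
    have := lip_of_step f p q D h y k hy hx'
    rw [abs_sub_comm]
    simpa using this

theorem Hull_mul {F : Type*} [Group F] (h g : Wreath ℤ F) (p q : ℤ) (hh : Hull (wlamp h) p q) (k : ℤ)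
    (hg : ∀ z, wlamp g z ≠ 1 → |z| ≤ k) (h1 : k < wpos h - p) (h2 : k < q - wpos h) :
    Hull (wlamp (h * g)) p q := by
  have key : ∀ z, k < |z - wpos h| → wlamp (h * g) z = wlamp h z := by
    intro z hz
    rw [wlamp_mul]
    have : wlamp g (z - wpos h) = 1 := by
      by_contra h3
      have := hg _ h3
      omega
    rw [this, mul_one]
  refine ⟨?_, ?_, ?_⟩
  · rw [key p]
    · exact hh.1
    · rw [lt_abs]; omega
  · rw [key q]
    · exact hh.2.1
    · rw [lt_abs]; omega
  · intro z hz
    by_cases h3 : k < |z - wpos h|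
    · rw [key z h3] at hz
      exact hh.2.2 z hz
    · rw [not_lt, abs_le] at h3
      omega

/-- the good set -/
def VV (F : Type*) [Group F] [Fintype F] (r t δ η R : ℝ) (n : ℕ) : Set (Wreath ℤ F) :=
  {h | ∃ p q : ℤ, Hull (wlamp h) p q ∧ δ * R ≤ ((wpos h - p : ℤ) : ℝ) ∧ δ * R ≤ ((q - wpos h : ℤ) : ℝ) ∧
    η * (Fintype.card F : ℝ)⁻¹ ^ ((q - p + 1).toNat) / R ^ 3 ≤ (PP F r t n).coeff h}

theorem VV_inv (F : Type*) [Group F] [Fintype F] [Nontrivial F] {r t : ℝ} (hr : 0 < r) (ht : 0 < t) (hrt : r + 2 * t = 1)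
    (ε δ η : ℝ) (hε : 0 < ε) (hδ : 0 < δ) (hη : 0 < η) :
    ∃ c > 0, ∀ (n : ℕ) (R : ℝ), 0 < R → ∀ h ∈ VV F r t δ η R n, ∀ g : Wreath ℤ F,
      (wordLength (stdGenZ F) g : ℝ) ≤ c * R →
        (1 - ε) * (PP F r t n).coeff h ≤ (PP F r t n).coeff (h * g) ∧
          (PP F r t n).coeff (h * g) ≤ (1 + ε) * (PP F r t n).coeff h := by
  have hm : (2 : ℝ) ≤ Fintype.card F := by exact_mod_cast Fintype.one_lt_card
  obtain ⟨C, hC, hQ⟩ := QQ_grad hr ht hrt _ hm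
  refine ⟨min (δ / 2) (ε * η * (16 * δ ^ 4) / C), by positivity, ?_⟩
  intro n R hR h hh g hg
  obtain ⟨p, q, hH, h1, h2, h3⟩ := hh
  obtain ⟨w1, w2⟩ := wl_bound g
  set k : ℕ := wordLength (stdGenZ F) g with hk
  have hk1 : (k : ℝ) ≤ δ / 2 * R := hg.trans (by gcongr; exact min_le_left _ _)
  have hk2 : (k : ℝ) ≤ (ε * η * (16 * δ ^ 4) / C) * R := hg.trans (by gcongr; exact min_le_right _ _)
  have hδR : δ / 2 * R < δ * R := by
    have : 0 < δ * R := by positivity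
    linarith
  have i1 : (k : ℤ) < wpos h - p := by
    have : ((k : ℤ) : ℝ) < ((wpos h - p : ℤ) : ℝ) := by
      simp only [Int.cast_natCast]; linarith
    exact_mod_cast this
  have i2 : (k : ℤ) < q - wpos h := by
    have : ((k : ℤ) : ℝ) < ((q - wpos h : ℤ) : ℝ) := by
      simp only [Int.cast_natCast]; linarith
    exact_mod_cast this
  have hH' := Hull_mul h g p q hH k w2 i1 i2
  have e1 := PP_hull F hr ht n h p q hH
  have e2 := PP_hull F hr ht n (h * g) p q hH'
  rw [abs_le] at w1
  have hd := lip_of_step' (QQ r t (Fintype.card F) n p q) p q _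
    (fun y hy hy' => hQ n p q y (by omega) hy hy') (wpos h) (wpos (h * g)) (by omega) (by omega)
    (by rw [wpos_mul]; omega) (by rw [wpos_mul]; omega)
  rw [← e1, ← e2, wpos_mul, add_sub_cancel_left] at hd
  set u : ℝ := (Fintype.card F : ℝ)⁻¹ ^ ((q - p + 1).toNat) with hu
  have hu0 : 0 < u := by positivity
  have hw : |((wpos g : ℤ) : ℝ)| ≤ (ε * η * (16 * δ ^ 4) / C) * R := by
    refine le_trans ?_ hk2
    rw [abs_le]
    constructor
    · exact_mod_cast w1.1
    · exact_mod_cast w1.2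
  have hL : 2 * δ * R ≤ ((q - p : ℤ) : ℝ) := by
    push_cast at h1 h2 ⊢; linarith
  have hb : |((wpos g : ℤ) : ℝ)| * (C * u / ((q - p : ℤ) : ℝ) ^ 4) ≤ ε * (η * u / R ^ 3) := by
    calc _ ≤ (ε * η * (16 * δ ^ 4) / C) * R * (C * u / (2 * δ * R) ^ 4) := by gcongr
      _ = ε * (η * u / R ^ 3) := by field_simp; norm_num
  have hb2 : ε * (η * u / R ^ 3) ≤ ε * (PP F r t n).coeff h := by gcongr
  have := (hd.trans hb).trans hb2
  rw [abs_le] at this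
  constructor <;> linarith [this.1, this.2]

theorem fE_near {r t : ℝ} (hr : 0 < r) (ht : 0 < t) (hrt : r + 2 * t = 1) (n : ℕ) (hn : 1 ≤ n) (Λ : ℝ) (hΛ : 1 ≤ Λ) :
    fE r t n (fun z => if |2 * (z : ℝ) + 1| < 2 * Λ + 1 then 1 else 0) ≤ 36 * Λ / (t * Real.sqrt n) := by
  have hs : 0 < Real.sqrt n := Real.sqrt_pos.2 (by exact_mod_cast hn)
  have hsup : ∀ z, pw r t n z ≤ 6 / (t * Real.sqrt n) := by
    intro z
    have h := pw_sup hr ht hrt n 0 z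
    simp only [pow_zero, one_mul, zero_add, Nat.factorial_one, Nat.cast_one, mul_one, pow_one] at h
    have h0 : (0 : ℝ) < (n : ℝ) + 1 := by positivity
    have hs1 : 0 < Real.sqrt ((n : ℝ) + 1) := Real.sqrt_pos.2 h0
    have hsq : Real.sqrt ((n : ℝ) + 1) * Real.sqrt ((n : ℝ) + 1) = n + 1 := Real.mul_self_sqrt h0.le
    have hle : Real.sqrt n ≤ Real.sqrt ((n : ℝ) + 1) := Real.sqrt_le_sqrt (by linarith)
    have h2 : pw r t n z ≤ 6 / (t * Real.sqrt ((n : ℝ) + 1)) := by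
      rw [le_div_iff₀ (by positivity)]
      rw [le_div_iff₀ ht] at h
      have : (pw r t n z * (t * Real.sqrt ((n : ℝ) + 1))) * Real.sqrt ((n : ℝ) + 1) ≤ 6 * Real.sqrt ((n : ℝ) + 1) := by
        calc _ = pw r t n z * (Real.sqrt ((n : ℝ) + 1) * Real.sqrt ((n : ℝ) + 1)) * t := by ring
          _ ≤ _ := by rw [hsq]; exact h
      exact le_of_mul_le_mul_right this hs1
    refine h2.trans ?_
    gcongr
  unfold fE
  set N : ℕ := ⌈Λ⌉₊ with hN
  have hN1 : Λ ≤ N := Nat.le_ceil _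
  have hN2 : (N : ℝ) < Λ + 1 := Nat.ceil_lt_add_one (by linarith)
  rw [tsum_eq_sum (s := Finset.Icc (-(N : ℤ) - 1) N)]
  · calc _ ≤ ∑ z ∈ Finset.Icc (-(N : ℤ) - 1) N, 6 / (t * Real.sqrt n) := by
          apply Finset.sum_le_sum
          intro z _
          beta_reduce
          split_ifs
          · rw [mul_one]; exact hsup z
          · rw [mul_zero]; positivity
      _ = (2 * N + 2) * (6 / (t * Real.sqrt n)) := by
          rw [Finset.sum_const, nsmul_eq_mul, Int.card_Icc]
          congr 1
          have : ((N : ℤ) + 1 - (-(N : ℤ) - 1)).toNat = 2 * N + 2 := by omega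
          rw [this]; push_cast; ring
      _ ≤ (6 * Λ) * (6 / (t * Real.sqrt n)) := by
          gcongr; linarith
      _ = _ := by ring
  · intro z hz
    beta_reduce
    rw [if_neg, mul_zero]
    intro h
    apply hz
    rw [abs_lt] at h
    rw [Finset.mem_Icc]
    have a1 : (z : ℝ) < N := by linarith [h.2]
    have a2 : -(N : ℝ) - 1 < z := by linarith [h.1]
    have a1' : z < (N : ℤ) := by exact_mod_cast a1
    have a2' : -(N : ℤ) - 1 < z := by exact_mod_cast a2
    omega

theorem fE_sq {r t : ℝ} (hr : 0 < r) (ht : 0 < t) (hrt : r + 2 * t = 1) (n : ℕ) (hn : 1 ≤ n) :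
    fE r t n (fun z => (z : ℝ) ^ 2) ≤ 12 * n := by
  have h := fE_moment hr ht hrt n hn 2
  simp only [sq_abs, Nat.factorial] at h
  rw [Real.sq_sqrt (by positivity)] at h
  push_cast at h
  linarith

theorem fE_sq' {r t : ℝ} (hr : 0 < r) (ht : 0 < t) (hrt : r + 2 * t = 1) (n : ℕ) (hn : 1 ≤ n) :
    fE r t n (fun z => (2 * (z : ℝ) + 1) ^ 2) ≤ 98 * n := by
  have h1 : fE r t n (fun z => (2 * (z : ℝ) + 1) ^ 2) ≤ fE r t n (fun z => 8 * (z : ℝ) ^ 2 + 2) := by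
    apply fE_mono hr ht
    intro z
    nlinarith [sq_nonneg (2 * (z : ℝ) - 1)]
  have h2 : fE r t n (fun z => 8 * (z : ℝ) ^ 2 + 2) = 8 * fE r t n (fun z => (z : ℝ) ^ 2) + 2 := by
    have h3 := fE_one hrt n
    rw [← EE_pos] at h3 ⊢
    rw [← EE_pos]
    have : (fun s : St => 8 * (s.2.2 : ℝ) ^ 2 + 2) = (8 : ℝ) • (fun s : St => (s.2.2 : ℝ) ^ 2) + (2 : ℝ) • (fun _ => (1 : ℝ)) := by
      funext s; simp
    rw [this, map_add, map_smul, map_smul, h3]; simp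
  have h3 := fE_sq hr ht hrt n hn
  have hn' : (1 : ℝ) ≤ n := by exact_mod_cast hn
  linarith

/-- good states of the walk -/
def good (Λ B : ℝ) (s : St) : Prop :=
  Λ ≤ ((s.2.2 - s.1 : ℤ) : ℝ) ∧ Λ ≤ ((s.2.1 - s.2.2 : ℤ) : ℝ) ∧ -(s.1 : ℝ) ≤ B ∧ (s.2.1 : ℝ) ≤ B

theorem good_mass {r t : ℝ} (hr : 0 < r) (ht : 0 < t) (hrt : r + 2 * t = 1) (n : ℕ) (hn : 1 ≤ n) (Λ B : ℝ)
    (hΛ : 1 ≤ Λ) (hB : 0 < B) :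
    1 - 72 * Λ / (t * Real.sqrt n) - 880 * n / B ^ 2 ≤ EE r t n (fun s => if good Λ B s then 1 else 0) := by
  let f : ℤ → ℝ := fun z => if |2 * (z : ℝ) + 1| < 2 * Λ + 1 then 1 else 0
  let g : ℤ → ℝ := fun z => (2 * (z : ℝ) + 1) ^ 2
  have hf : ∀ z, f (-1 - z) = f z := by
    intro z
    simp only [f]
    have : |2 * ((-1 - z : ℤ) : ℝ) + 1| = |2 * (z : ℝ) + 1| := by
      rw [← abs_neg]; congr 1; push_cast; ring
    rw [this]
  have hg : ∀ z, g (-1 - z) = g z := by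
    intro z
    simp only [g]; push_cast; ring
  have f0 : ∀ z, 0 ≤ f z := by intro z; simp only [f]; split_ifs <;> norm_num
  have f1 : ∀ z : ℤ, 0 ≤ z → (z : ℝ) < Λ → f z = 1 := by
    intro z hz h
    have : (0 : ℝ) ≤ z := by exact_mod_cast hz
    simp only [f]; rw [if_pos]
    rw [abs_lt]; constructor <;> linarith
  have E1 := EE_top hr ht n f hf
  have E2 := EE_bot hr ht n f hf
  have E3 := EE_top hr ht n g hg
  have E4 := EE_bot hr ht n g hg
  have E5 := EE_pos (r := r) (t := t) n (fun z => (z : ℝ) ^ 2)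
  have E6 := EE_pos (r := r) (t := t) n (fun _ => (1 : ℝ))
  rw [fE_one hrt] at E6
  have b1 := fE_near hr ht hrt n hn Λ hΛ
  have b2 := fE_sq hr ht hrt n hn
  have b3 := fE_sq' hr ht hrt n hn
  let T : St → ℝ := (fun _ => (1 : ℝ)) - (fun s => f (s.2.1 - s.2.2)) - (fun s => f (s.2.2 - s.1))
    - (4 / B ^ 2) • ((fun s => ((s.2.2 : ℤ) : ℝ) ^ 2) + (fun s => g (s.2.1 - s.2.2)))
    - (4 / B ^ 2) • ((fun s => ((s.2.2 : ℤ) : ℝ) ^ 2) + (fun s => g (s.2.2 - s.1)))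
  have hT : EE r t n T ≤ EE r t n (fun s => if good Λ B s then 1 else 0) := by
    apply EE_mono hr ht
    intro s hs
    obtain ⟨a, b, x⟩ := s
    simp only [Rch] at hs
    have c1 : (0 : ℝ) ≤ ((x - a : ℤ) : ℝ) := by exact_mod_cast (by omega)
    have c2 : (0 : ℝ) ≤ ((b - x : ℤ) : ℝ) := by exact_mod_cast (by omega)
    simp only [T, Pi.sub_apply, Pi.add_apply, Pi.smul_apply, smul_eq_mul]
    have p1 := f0 (b - x)
    have p2 := f0 (x - a)
    have p3 : 0 ≤ 4 / B ^ 2 * ((x : ℝ) ^ 2 + g (b - x)) := by simp only [g]; positivity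
    have p4 : 0 ≤ 4 / B ^ 2 * ((x : ℝ) ^ 2 + g (x - a)) := by simp only [g]; positivity
    have key : ∀ y : ℤ, (0 : ℝ) ≤ (y : ℝ) → B < |(x : ℝ)| + y → 1 ≤ 4 / B ^ 2 * ((x : ℝ) ^ 2 + g y) := by
      intro y hy h
      have : B ^ 2 / 4 ≤ (x : ℝ) ^ 2 + g y := by
        simp only [g]
        by_cases hx : B / 2 ≤ |(x : ℝ)|
        · have : (B / 2) ^ 2 ≤ |(x : ℝ)| ^ 2 := by gcongr
          rw [sq_abs] at this
          nlinarith [sq_nonneg (2 * (y : ℝ) + 1)]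
        · have h1 : B / 2 ≤ 2 * (y : ℝ) + 1 := by linarith
          have : (B / 2) ^ 2 ≤ (2 * (y : ℝ) + 1) ^ 2 := by gcongr
          nlinarith [sq_nonneg (x : ℝ)]
      calc (1 : ℝ) = 4 / B ^ 2 * (B ^ 2 / 4) := by field_simp
        _ ≤ _ := by gcongr
    by_cases hgood : good Λ B (a, b, x)
    · rw [if_pos hgood]; linarith
    · rw [if_neg hgood]
      simp only [good] at hgood
      by_cases q1 : Λ ≤ ((x - a : ℤ) : ℝ)
      swap
      · have := f1 (x - a) (by omega) (by linarith); linarith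
      by_cases q2 : Λ ≤ ((b - x : ℤ) : ℝ)
      swap
      · have := f1 (b - x) (by omega) (by linarith); linarith
      by_cases q3 : -(a : ℝ) ≤ B
      swap
      · have := key (x - a) c1 (by
          have := neg_le_abs (x : ℝ)
          push_cast; linarith)
        linarith
      by_cases q4 : (b : ℝ) ≤ B
      swap
      · have := key (b - x) c2 (by
          have := le_abs_self (x : ℝ)
          push_cast; linarith)
        linarith
      exact absurd ⟨q1, q2, q3, q4⟩ hgood
  refine le_trans ?_ hT
  simp only [T, map_sub, map_add, map_smul, smul_eq_mul]
  rw [E1, E2, E3, E4, E5, E6]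
  have b4 : 4 / B ^ 2 * (fE r t n (fun z => (z : ℝ) ^ 2) + fE r t n g) ≤ 4 / B ^ 2 * (110 * n) := by
    have : fE r t n g ≤ 98 * n := b3
    gcongr; linarith
  have b5 : 4 / B ^ 2 * (110 * (n : ℝ)) = 880 * n / B ^ 2 / 2 := by ring
  have b6 : fE r t n f ≤ 72 * Λ / (t * Real.sqrt n) / 2 := by
    refine le_trans b1 (le_of_eq ?_); ring
  linarith

/-- extension by `1` of a finite configuration -/
def wext {F : Type*} [Group F] (a b w : ℤ) (ψ : {z // z ∈ Finset.Icc a b} → F) : Wreath ℤ F :=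
  ⟨⟨fun z => if hz : z ∈ Finset.Icc a b then ψ ⟨z, hz⟩ else 1, by
    refine (Finset.finite_toSet (Finset.Icc a b)).subset ?_
    intro z hz
    by_contra h
    apply hz
    have h' : ¬ z ∈ Finset.Icc a b := h
    exact dif_neg h'⟩, Multiplicative.ofAdd w⟩

theorem wlamp_wext {F : Type*} [Group F] (a b w : ℤ) (ψ : {z // z ∈ Finset.Icc a b} → F) (z : ℤ) :
    wlamp (wext a b w ψ) z = if hz : z ∈ Finset.Icc a b then ψ ⟨z, hz⟩ else 1 := rfl

theorem wpos_wext {F : Type*} [Group F] (a b w : ℤ) (ψ : {z // z ∈ Finset.Icc a b} → F) :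
    wpos (wext a b w ψ) = w := rfl

/-- elements at `w` with lamps in `[a,b]` -/
def BX (F : Type*) [Group F] [Fintype F] (a b w : ℤ) : Finset (Wreath ℤ F) :=
  Finset.univ.image (wext a b w)

theorem mem_BX {F : Type*} [Group F] [Fintype F] (a b w : ℤ) (h : Wreath ℤ F) :
    h ∈ BX F a b w ↔ wpos h = w ∧ ∀ z, wlamp h z ≠ 1 → a ≤ z ∧ z ≤ b := by
  unfold BX
  rw [Finset.mem_image]
  constructor
  · rintro ⟨ψ, _, rfl⟩
    refine ⟨rfl, fun z hz => ?_⟩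
    by_contra h
    apply hz
    rw [wlamp_wext, dif_neg]
    rw [Finset.mem_Icc]; exact h
  · rintro ⟨h1, h2⟩
    refine ⟨fun z => wlamp h z, Finset.mem_univ _, ?_⟩
    apply w_ext
    · funext z
      rw [wlamp_wext]
      split_ifs with hz
      · rfl
      · by_contra h3
        apply hz
        rw [Finset.mem_Icc]
        exact h2 z (fun h => h3 h.symm)
    · exact h1.symm

theorem card_BX (F : Type*) [Group F] [Fintype F] (a b w : ℤ) :
    (BX F a b w).card = Fintype.card F ^ ((b - a + 1).toNat) := by
  unfold BX
  rw [Finset.card_image_of_injective]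
  · rw [Finset.card_univ, Fintype.card_fun, Fintype.card_coe, Int.card_Icc]
    congr 2; ring
  · intro ψ ψ' h
    funext ⟨z, hz⟩
    have := congrArg (fun g => wlamp g z) h
    simp only [wlamp_wext, dif_pos hz] at this
    exact this

/-- all reachable elements -/
def OM (F : Type*) [Group F] [Fintype F] (n : ℕ) : Finset (Wreath ℤ F) :=
  (Finset.Icc (-(n : ℤ)) n).biUnion (BX F (-(n : ℤ)) n)

theorem exists_hull {F : Type*} [Group F] (φ : ℤ → F) (a b J : ℤ)
    (h : ∀ z, φ z ≠ 1 → a ≤ z ∧ z ≤ b)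
    (h1 : ¬ ∀ z, φ z ≠ 1 → a + J ≤ z ∧ z ≤ b) (h2 : ¬ ∀ z, φ z ≠ 1 → a ≤ z ∧ z ≤ b - J) :
    ∃ p q, Hull φ p q ∧ a ≤ p ∧ p < a + J ∧ b - J < q ∧ q ≤ b := by
  push Not at h1 h2
  obtain ⟨z1, hz1, h1⟩ := h1
  obtain ⟨z2, hz2, h2⟩ := h2
  set s : Finset ℤ := (Finset.Icc a b).filter (fun z => φ z ≠ 1) with hs
  have mem : ∀ z, z ∈ s ↔ φ z ≠ 1 := by
    intro z
    rw [hs, Finset.mem_filter, Finset.mem_Icc]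
    exact ⟨fun hh => hh.2, fun hh => ⟨h z hh, hh⟩⟩
  have hne : s.Nonempty := ⟨z1, (mem z1).mpr hz1⟩
  have m1 := (mem _).mp (s.min'_mem hne)
  have m2 := (mem _).mp (s.max'_mem hne)
  have m3 := s.min'_le z1 ((mem _).mpr hz1)
  have m4 := s.le_max' z2 ((mem _).mpr hz2)
  have n1 := h _ m1
  have n2 := h _ m2
  have n3 := h _ hz1
  have n4 := h _ hz2
  refine ⟨s.min' hne, s.max' hne, ⟨m1, m2, fun z hz => ⟨s.min'_le z ((mem _).mpr hz), s.le_max' z ((mem _).mpr hz)⟩⟩,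
    n1.1, ?_, ?_, n2.2⟩
  · by_contra h5
    have := h1 (by omega)
    omega
  · have := h2 n4.1
    omega

/-- geometric part of the good set -/
def V0 (F : Type*) [Group F] (Λ B : ℝ) (h : Wreath ℤ F) : Prop :=
  ∃ p q : ℤ, Hull (wlamp h) p q ∧ Λ ≤ ((wpos h - p : ℤ) : ℝ) ∧ Λ ≤ ((q - wpos h : ℤ) : ℝ) ∧
    -(p : ℝ) ≤ B ∧ (q : ℝ) ≤ B

theorem V0_count (F : Type*) [Group F] [Fintype F] [Nontrivial F] (n : ℕ) (Λ B : ℝ) (J : ℕ) (s : St)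
    (hs : Rch n s) (hJ : (J : ℝ) ≤ Λ) (hg : good (2 * Λ) B s) :
    1 - 2 * (1 / 2 : ℝ) ^ J ≤ ∑ h ∈ (OM F n).filter (V0 F Λ B), Fh (wlamp h) (wpos h) s := by
  obtain ⟨a, b, w⟩ := s
  simp only [Rch] at hs
  simp only [good] at hg
  have hm : (2 : ℝ) ≤ Fintype.card F := by exact_mod_cast Fintype.one_lt_card
  set m : ℝ := (Fintype.card F : ℝ) with hmdef
  have hm0 : m ≠ 0 := by positivity
  have hbaJ : (2 * J : ℤ) ≤ b - a := by
    have : ((2 * J : ℤ) : ℝ) ≤ ((b - a : ℤ) : ℝ) := by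
      push_cast at hg ⊢
      linarith [hg.1, hg.2.1, (Nat.cast_nonneg J : (0 : ℝ) ≤ J)]
    exact_mod_cast this
  set L := (b - a + 1).toNat with hL
  set W := BX F a b w with hW
  have hsub : W \ (BX F (a + J) b w ∪ BX F a (b - J) w) ⊆ (OM F n).filter (V0 F Λ B) := by
    intro h hh
    rw [Finset.mem_sdiff, Finset.mem_union, not_or, mem_BX, mem_BX, mem_BX] at hh
    obtain ⟨⟨h1, h2⟩, h3, h4⟩ := hh
    have h3' := fun hc => h3 ⟨h1, hc⟩
    have h4' := fun hc => h4 ⟨h1, hc⟩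
    obtain ⟨p, q, hH, k1, k2, k3, k4⟩ := exists_hull (wlamp h) a b J h2 h3' h4'
    rw [Finset.mem_filter]
    refine ⟨?_, p, q, hH, ?_, ?_, ?_, ?_⟩
    · unfold OM
      rw [Finset.mem_biUnion]
      refine ⟨w, ?_, ?_⟩
      · rw [Finset.mem_Icc]; omega
      · rw [mem_BX]
        refine ⟨h1, fun z hz => ?_⟩
        have := h2 z hz
        omega
    · rw [h1]
      have : (p : ℝ) ≤ a + J := by exact_mod_cast k2.le
      push_cast at hg ⊢; linarith [hg.1]
    · rw [h1]
      have : (b : ℝ) - J ≤ q := by exact_mod_cast k3.le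
      push_cast at hg ⊢; linarith [hg.2.1]
    · have : (a : ℝ) ≤ p := by exact_mod_cast k1
      linarith [hg.2.2.1]
    · have : (q : ℝ) ≤ b := by exact_mod_cast k4
      linarith [hg.2.2.2]
  have hFn : ∀ h : Wreath ℤ F, 0 ≤ Fh (wlamp h) (wpos h) (a, b, w) := by
    intro h; rw [Fh_mk]; split_ifs <;> positivity
  have c1 := card_BX F a b w
  have c2 := card_BX F (a + J) b w
  have c3 := card_BX F a (b - J) w
  have l1 : L = (b - (a + J) + 1).toNat + J := by omega
  have l2 : L = (b - J - a + 1).toNat + J := by omega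
  have hcard : (W.card : ℝ) - ((BX F (a + J) b w).card + (BX F a (b - J) w).card) ≤
      ((W \ (BX F (a + J) b w ∪ BX F a (b - J) w)).card : ℝ) := by
    have h1 := Finset.le_card_sdiff (BX F (a + J) b w ∪ BX F a (b - J) w) W
    have h2 := Finset.card_union_le (BX F (a + J) b w) (BX F a (b - J) w)
    have h3 : W.card ≤ (W \ (BX F (a + J) b w ∪ BX F a (b - J) w)).card +
      ((BX F (a + J) b w).card + (BX F a (b - J) w).card) := by omega
    have h4 : (W.card : ℝ) ≤ (W \ (BX F (a + J) b w ∪ BX F a (b - J) w)).card +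
      ((BX F (a + J) b w).card + (BX F a (b - J) w).card) := by exact_mod_cast h3
    linarith
  calc 1 - 2 * (1 / 2 : ℝ) ^ J ≤ 1 - 2 * (m⁻¹) ^ J := by
        have : m⁻¹ ≤ 1 / 2 := by
          rw [inv_eq_one_div]; exact one_div_le_one_div_of_le (by norm_num) hm
        have : m⁻¹ ^ J ≤ (1 / 2 : ℝ) ^ J := by gcongr
        linarith
    _ = (m ^ L - (m ^ ((b - (a + J) + 1).toNat) + m ^ ((b - J - a + 1).toNat))) * m⁻¹ ^ L := by
        have e1 : m ^ L * m⁻¹ ^ L = 1 := by rw [← mul_pow, mul_inv_cancel₀ hm0, one_pow]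
        have e2 : ∀ k, L = k + J → m ^ k * m⁻¹ ^ L = m⁻¹ ^ J := by
          intro k hk
          rw [hk, pow_add, ← mul_assoc, ← mul_pow, mul_inv_cancel₀ hm0, one_pow, one_mul]
        rw [sub_mul, add_mul, e1, e2 _ l1, e2 _ l2]; ring
    _ ≤ ((W \ (BX F (a + J) b w ∪ BX F a (b - J) w)).card : ℝ) * m⁻¹ ^ L := by
        rw [hW, c1, c2, c3] at hcard
        push_cast at hcard
        gcongr
    _ = ∑ h ∈ W \ (BX F (a + J) b w ∪ BX F a (b - J) w), Fh (wlamp h) (wpos h) (a, b, w) := by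
        rw [← nsmul_eq_mul, ← Finset.sum_const]
        apply Finset.sum_congr rfl
        intro h hh
        rw [Finset.mem_sdiff, mem_BX] at hh
        rw [Fh_mk, if_pos ⟨hh.1.1.symm, hh.1.2⟩]
    _ ≤ _ := Finset.sum_le_sum_of_subset_of_nonneg hsub fun h _ _ => hFn h

theorem PP_nonneg (F : Type*) [Group F] [Fintype F] {r t : ℝ} (hr : 0 < r) (ht : 0 < t) (n : ℕ) (h : Wreath ℤ F) :
    0 ≤ (PP F r t n).coeff h := by
  rw [PP_formula F hr ht]
  apply EE_nonneg hr ht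
  intro s _
  unfold Fh
  split_ifs <;> positivity

theorem V0_mass (F : Type*) [Group F] [Fintype F] [Nontrivial F] {r t : ℝ} (hr : 0 < r) (ht : 0 < t)
    (n : ℕ) (Λ B : ℝ) (J : ℕ) (hJ : (J : ℝ) ≤ Λ) :
    (1 - 2 * (1 / 2 : ℝ) ^ J) * EE r t n (fun s => if good (2 * Λ) B s then 1 else 0) ≤
      ∑ h ∈ (OM F n).filter (V0 F Λ B), (PP F r t n).coeff h := by
  simp only [PP_formula F hr ht]
  rw [← map_sum, ← smul_eq_mul, ← map_smul]
  apply EE_mono hr ht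
  intro s hs
  simp only [Pi.smul_apply, smul_eq_mul, Finset.sum_apply]
  by_cases hg : good (2 * Λ) B s
  · rw [if_pos hg, mul_one]
    exact V0_count F n Λ B J s hs hJ hg
  · rw [if_neg hg, mul_zero]
    apply Finset.sum_nonneg
    intro h _
    unfold Fh
    split_ifs <;> positivity

theorem small_mass (F : Type*) [Group F] [Fintype F] (P : Wreath ℤ F → ℝ) (A : ℝ) (hA : 0 ≤ A) (B : ℝ) (hB : 0 ≤ B)
    (T : Finset (Wreath ℤ F))
    (hT : ∀ h ∈ T, ∃ p q : ℤ, Hull (wlamp h) p q ∧ p ≤ wpos h ∧ wpos h ≤ q ∧ -(p : ℝ) ≤ B ∧ (q : ℝ) ≤ B ∧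
      P h ≤ A * (Fintype.card F : ℝ)⁻¹ ^ ((q - p + 1).toNat)) :
    ∑ h ∈ T, P h ≤ (2 * B + 1) ^ 3 * A := by
  set M : ℕ := ⌊B⌋₊ with hM
  have hMB : (M : ℝ) ≤ B := Nat.floor_le hB
  set I := Finset.Icc (-(M : ℤ)) M with hI
  set m : ℝ := (Fintype.card F : ℝ) with hmdef
  have hm0 : 0 < m := by
    have : 0 < Fintype.card F := Fintype.card_pos
    rw [hmdef]; exact_mod_cast this
  have le1 : ∀ z : ℤ, (z : ℝ) ≤ B → z ≤ M := by
    intro z hz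
    by_contra h
    have h1 : (M : ℤ) + 1 ≤ z := by omega
    have h2 : (M : ℝ) + 1 ≤ z := by exact_mod_cast h1
    have := Nat.lt_floor_add_one B
    linarith
  let c : ℤ × ℤ × ℤ → ℝ := fun k => A * m⁻¹ ^ ((k.2.1 - k.1 + 1).toNat)
  have hc : ∀ k, 0 ≤ c k := by intro k; simp only [c]; positivity
  calc ∑ h ∈ T, P h ≤ ∑ h ∈ T, ∑ k ∈ I ×ˢ I ×ˢ I, (if h ∈ BX F k.1 k.2.1 k.2.2 then c k else 0) := by
        apply Finset.sum_le_sum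
        intro h hh
        obtain ⟨p, q, hH, h1, h2, h3, h4, h5⟩ := hT h hh
        have j1 := le1 q h4
        have j2 := le1 (-p) (by push_cast; exact h3)
        have hk : (p, q, wpos h) ∈ I ×ˢ I ×ˢ I := by
          simp only [Finset.mem_product, hI, Finset.mem_Icc]
          omega
        have hle := Finset.single_le_sum (f := fun k : ℤ × ℤ × ℤ => if h ∈ BX F k.1 k.2.1 k.2.2 then c k else 0)
          (fun k _ => by
            show (0 : ℝ) ≤ if h ∈ BX F k.1 k.2.1 k.2.2 then c k else 0
            split_ifs
            · exact hc k
            · exact le_rfl) hk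
        refine le_trans ?_ hle
        show P h ≤ if h ∈ BX F p q (wpos h) then c (p, q, wpos h) else 0
        rw [if_pos]
        · exact h5
        · rw [mem_BX]; exact ⟨rfl, hH.2.2⟩
    _ = ∑ k ∈ I ×ˢ I ×ˢ I, ∑ h ∈ T, (if h ∈ BX F k.1 k.2.1 k.2.2 then c k else 0) := Finset.sum_comm
    _ ≤ ∑ k ∈ I ×ˢ I ×ˢ I, A := by
        apply Finset.sum_le_sum
        intro k _
        rw [← Finset.sum_filter, Finset.sum_const, nsmul_eq_mul]
        have h1 : (T.filter (fun h => h ∈ BX F k.1 k.2.1 k.2.2)).card ≤ (BX F k.1 k.2.1 k.2.2).card := by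
          apply Finset.card_le_card
          intro h hh
          exact (Finset.mem_filter.mp hh).2
        rw [card_BX] at h1
        have h2 : ((T.filter (fun h => h ∈ BX F k.1 k.2.1 k.2.2)).card : ℝ) ≤ m ^ ((k.2.1 - k.1 + 1).toNat) := by
          rw [hmdef]; exact_mod_cast h1
        calc _ ≤ m ^ ((k.2.1 - k.1 + 1).toNat) * c k := mul_le_mul_of_nonneg_right h2 (hc k)
          _ = A * (m * m⁻¹) ^ ((k.2.1 - k.1 + 1).toNat) := by simp only [c]; rw [mul_pow]; ring
          _ = A := by rw [mul_inv_cancel₀ hm0.ne', one_pow, mul_one]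
    _ = (2 * M + 1) ^ 3 * A := by
        rw [Finset.sum_const, nsmul_eq_mul, Finset.card_product, Finset.card_product, hI, Int.card_Icc]
        have : ((M : ℤ) + 1 - -(M : ℤ)).toNat = 2 * M + 1 := by omega
        rw [this]; push_cast; ring
    _ ≤ _ := by gcongr

theorem sum_le_measOf {G : Type*} [Group G] (x : MonoidAlgebra ℝ G) (hx : ∀ g, 0 ≤ x.coeff g) (T : Finset G) (V : Set G)
    (hT : ∀ g ∈ T, g ∈ V) : ∑ g ∈ T, x.coeff g ≤ measOf (fun g => x.coeff g) V := by
  unfold measOf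
  have e : ∑ g ∈ T, x.coeff g = ∑ g ∈ T.subtype (· ∈ V), x.coeff (g : G) := by
    rw [Finset.sum_subtype_of_mem (fun g => x.coeff g) hT]
  rw [e]
  apply Summable.sum_le_tsum _ (fun i _ => hx _)
  have : Summable (fun g => x.coeff g) :=
    summable_of_ne_finset_zero (s := x.coeff.support) (fun b hb => Finsupp.notMem_support_iff.mp hb)
  exact this.subtype V

theorem VV_mass (F : Type*) [Group F] [Fintype F] [Nontrivial F] {r t : ℝ} (hr : 0 < r) (ht : 0 < t) (hrt : r + 2 * t = 1)
    (ε : ℝ) (hε : 0 < ε) : ∃ δ > 0, ∃ η > 0, ∃ N : ℕ, 1 ≤ N ∧ ∀ n ≥ N,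
      1 - ε ≤ measOf (fun g => (PP F r t n).coeff g) (VV F r t δ η (Real.sqrt n) n) := by
  set K : ℝ := 1 + 7040 / ε with hK
  have hK1 : 1 ≤ K := by rw [hK]; have : 0 < 7040 / ε := by positivity
                         linarith
  set δ : ℝ := ε * t / 1152 with hδ
  have hδ0 : 0 < δ := by positivity
  set η : ℝ := ε / (4 * (2 * K + 1) ^ 3) with hη
  have hη0 : 0 < η := by positivity
  obtain ⟨J0, hJ0⟩ := exists_pow_lt_of_lt_one (show (0 : ℝ) < ε / 16 by positivity) (show (1 / 2 : ℝ) < 1 by norm_num)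
  set J := J0 + 1 with hJ
  have hJe : 2 * (1 / 2 : ℝ) ^ J ≤ ε / 8 := by
    rw [hJ, pow_succ]; have : (0 : ℝ) < (1 / 2) ^ J0 := by positivity
    linarith
  have hJ1 : 2 * (1 / 2 : ℝ) ^ J ≤ 1 := by
    rw [hJ, pow_succ]
    have : (1 / 2 : ℝ) ^ J0 ≤ 1 := pow_le_one₀ (by norm_num) (by norm_num)
    linarith
  refine ⟨δ, hδ0, η, hη0, max 1 ⌈(J / δ) ^ 2⌉₊, le_max_left _ _, ?_⟩
  intro n hn
  have hn1 : 1 ≤ n := (le_max_left _ _).trans hn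
  have hn2 : (J / δ) ^ 2 ≤ (n : ℝ) := by
    have h1 : (⌈(J / δ) ^ 2⌉₊ : ℝ) ≤ n := by exact_mod_cast (le_max_right _ _).trans hn
    exact (Nat.le_ceil _).trans h1
  have hn1' : (1 : ℝ) ≤ n := by exact_mod_cast hn1
  set R := Real.sqrt n with hR
  have hR1 : 1 ≤ R := Real.one_le_sqrt.mpr hn1'
  have hR0 : 0 < R := by linarith
  have hRsq : R ^ 2 = n := Real.sq_sqrt (by positivity)
  have hJR : (J : ℝ) ≤ δ * R := by
    have : (J : ℝ) / δ ≤ R := Real.le_sqrt_of_sq_le hn2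
    rw [div_le_iff₀ hδ0] at this
    linarith
  have hJge : (1 : ℝ) ≤ J := by rw [hJ]; push_cast; linarith [(Nat.cast_nonneg J0 : (0 : ℝ) ≤ J0)]
  have g1 := good_mass hr ht hrt n hn1 (2 * (δ * R)) (K * R) (by linarith) (by positivity)
  have g2 := V0_mass F hr ht n (δ * R) (K * R) J hJR
  have e1 : 72 * (2 * (δ * R)) / (t * Real.sqrt n) = ε / 8 := by
    rw [← hR, hδ]; field_simp; norm_num
  have e2 : 880 * (n : ℝ) / (K * R) ^ 2 ≤ ε / 8 := by
    rw [← hRsq]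
    have h1 : 880 * R ^ 2 / (K * R) ^ 2 = 880 / K ^ 2 := by field_simp
    rw [h1, div_le_iff₀ (by positivity)]
    have h2 : ε / 8 * K = ε / 8 + 880 := by rw [hK]; field_simp; norm_num
    have h3 : ε / 8 * K ≤ ε / 8 * K ^ 2 := by
      apply mul_le_mul_of_nonneg_left _ (by positivity)
      nlinarith
    linarith
  rw [e1] at g1
  have g3 : 1 - 3 * ε / 8 ≤ ∑ h ∈ (OM F n).filter (V0 F (δ * R) (K * R)), (PP F r t n).coeff h := by
    refine le_trans ?_ g2
    set e3 := 2 * (1 / 2 : ℝ) ^ J with he3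
    have he30 : 0 ≤ e3 := by positivity
    have : (1 - e3) * (1 - ε / 4) ≤ (1 - e3) * EE r t n (fun s => if good (2 * (δ * R)) (K * R) s then 1 else 0) := by
      apply mul_le_mul_of_nonneg_left _ (by linarith)
      linarith
    refine le_trans ?_ this
    nlinarith
  set V := VV F r t δ η R n with hV
  rw [← Finset.sum_filter_add_sum_filter_not _ (fun h => h ∈ V)] at g3
  have g4 := small_mass F (fun h => (PP F r t n).coeff h) (η / R ^ 3) (by positivity) (K * R) (by positivity)
    (((OM F n).filter (V0 F (δ * R) (K * R))).filter (fun h => h ∉ V)) (by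
      intro h hh
      rw [Finset.mem_filter, Finset.mem_filter] at hh
      obtain ⟨⟨_, p, q, hH, h1, h2, h3, h4⟩, h5⟩ := hh
      have hpos : 0 < δ * R := by positivity
      refine ⟨p, q, hH, ?_, ?_, h3, h4, ?_⟩
      · have : (0 : ℝ) ≤ ((wpos h - p : ℤ) : ℝ) := by linarith
        have : (0 : ℤ) ≤ wpos h - p := by exact_mod_cast this
        omega
      · have : (0 : ℝ) ≤ ((q - wpos h : ℤ) : ℝ) := by linarith
        have : (0 : ℤ) ≤ q - wpos h := by exact_mod_cast this
        omega
      · by_contra h6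
        apply h5
        refine ⟨p, q, hH, h1, h2, ?_⟩
        rw [not_le] at h6
        refine le_trans (le_of_eq ?_) h6.le
        ring)
  have g5 : (2 * (K * R) + 1) ^ 3 * (η / R ^ 3) ≤ ε / 4 := by
    calc _ ≤ ((2 * K + 1) * R) ^ 3 * (η / R ^ 3) := by
          gcongr; linarith
      _ = ε / 4 := by rw [hη]; field_simp
  have g6 := sum_le_measOf (PP F r t n) (PP_nonneg F hr ht n)
    (((OM F n).filter (V0 F (δ * R) (K * R))).filter (fun h => h ∈ V)) V (fun g hg => (Finset.mem_filter.mp hg).2)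
  linarith

/-- (Theorem 1, part 1: almost invariance.) Let `G = ℤ ≀ F` with `F` a
finite group with at least two elements, and let `μ` be the standard simple
switch-walk-switch measure on `G`. For every `ε > 0` there exists `c > 0` such that for all
sufficiently large `n` there is a set `Vₙ` with `μ^{*n}(Vₙ) ≥ 1 - ε` on which
`|μ^{*n}(h g)/μ^{*n}(h) - 1| ≤ ε` for all `g` of word length at most `c √n`. -/
theorem stmt11 (F : Type*) [Group F] [Fintype F] [Nontrivial F]
    (ν : ℤ → ℝ) (hν0 : ∀ z, 0 ≤ ν z) (hν1 : HasSum ν 1)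
    (hνsym : ∀ z : ℤ, ν z = ν (-z))
    (hνsupp : Function.support ν = {-1, 0, 1}) :
    ∀ ε > (0 : ℝ), ∃ c > (0 : ℝ), ∃ N : ℕ, ∀ n ≥ N, ∃ V : Set (Wreath ℤ F),
      1 - ε ≤ measOf (convPow (swsMeasure ν) n) V ∧
      ∀ h ∈ V, ∀ g : Wreath ℤ F,
        (wordLength (stdGenZ F) g : ℝ) ≤ c * Real.sqrt n →
        (1 - ε) * convPow (swsMeasure ν) n h ≤ convPow (swsMeasure ν) n (h * g) ∧
          convPow (swsMeasure ν) n (h * g) ≤ (1 + ε) * convPow (swsMeasure ν) n h := by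
  intro ε hε
  have hsupp : ∀ z, ν z ≠ 0 ↔ z ∈ ({-1, 0, 1} : Set ℤ) := by
    intro z; rw [← hνsupp]; rfl
  have hr : 0 < ν 0 := lt_of_le_of_ne (hν0 0) (Ne.symm ((hsupp 0).mpr (by simp)))
  have ht : 0 < ν 1 := lt_of_le_of_ne (hν0 1) (Ne.symm ((hsupp 1).mpr (by simp)))
  have hrt : ν 0 + 2 * ν 1 = 1 := by
    have h1 : HasSum ν (∑ z ∈ ({-1, 0, 1} : Finset ℤ), ν z) := by
      apply hasSum_sum_of_ne_finset_zero
      intro z hz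
      by_contra h
      apply hz
      have := (hsupp z).mp h
      simpa using this
    have h2 := h1.unique hν1
    rw [Finset.sum_insert (by simp), Finset.sum_insert (by simp), Finset.sum_singleton] at h2
    have h3 := hνsym 1
    linarith
  obtain ⟨δ, hδ, η, hη, N, hN, hmass⟩ := VV_mass F hr ht hrt ε hε
  obtain ⟨c, hc, hinv⟩ := VV_inv F hr ht hrt ε δ η hε hδ hη
  refine ⟨c, hc, N, ?_⟩
  intro n hn
  have hn1 : 1 ≤ n := hN.trans hn
  have e : convPow (swsMeasure ν) n = fun h : Wreath ℤ F => (PP F (ν 0) (ν 1) n).coeff h :=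
    funext fun h => convPow_eq F ν hνsym hνsupp n hn1 h
  rw [e]
  refine ⟨VV F (ν 0) (ν 1) δ η (Real.sqrt n) n, hmass n hn, ?_⟩
  intro h hh g hg
  exact hinv n (Real.sqrt n) (Real.sqrt_pos.2 (by exact_mod_cast hn1)) h hh g hg
end
end

section
/- Let μ be a symmetric, finitely supported probability measure on ℤ whose support contains a nonzero element. There exist constants C₁, C₂ > 0 such that for all sufficiently large n and every real L with √n ≤ L ≤ n^{2/3}, the n-fold convolution satisfies μ^{*n}({x ∈ ℤ : x ≥ L}) ≥ C₁·(√n/L)·exp(−C₂·L²/n). -/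
noncomputable section
open Filter
open scoped Classical

/-- Convolution of two measures (as real-valued functions) on `ℤ`:
`(μ * ν)(x) = Σ_y μ(y) ν(x - y)`. -/
def convZ (μ ν : ℤ → ℝ) : ℤ → ℝ := fun x => ∑' y : ℤ, μ y * ν (x - y)

/-- `n`-fold convolution power on `ℤ`; `convZPow μ 0` is the point mass at `0`. -/
def convZPow (μ : ℤ → ℝ) : ℕ → ℤ → ℝ
  | 0 => fun x => if x = 0 then 1 else 0
  | n + 1 => convZ μ (convZPow μ n)

lemma convZPow_nonneg' (μ : ℤ → ℝ) (hμ0 : ∀ x, 0 ≤ μ x) (n : ℕ) (x : ℤ) :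
    0 ≤ convZPow μ n x := by
  induction n generalizing x with
  | zero => simp only [convZPow]; split_ifs <;> norm_num
  | succ n ih => exact tsum_nonneg fun y => mul_nonneg (hμ0 y) (ih _)

lemma hasSum_mgf (μ : ℤ → ℝ) (S : Finset ℤ) (hS : ∀ x, x ∉ S → μ x = 0) (t : ℝ) (n : ℕ) :
    HasSum (fun x : ℤ => convZPow μ n x * Real.exp (t * x))
      ((∑ y ∈ S, μ y * Real.exp (t * y)) ^ n) := by
  induction n with
  | zero =>
    have h := hasSum_ite_eq (0 : ℤ) (1 : ℝ)
    rw [pow_zero]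
    refine h.congr_fun ?_ |> fun h => h
    intro x
    by_cases hx : x = 0 <;> simp [convZPow, hx]
  | succ n ih =>
    have h1 : ∀ y ∈ S, HasSum (fun x : ℤ => μ y * Real.exp (t * y) *
        (convZPow μ n (x - y) * Real.exp (t * ((x - y : ℤ) : ℝ))))
        (μ y * Real.exp (t * y) * (∑ y ∈ S, μ y * Real.exp (t * y)) ^ n) := by
      intro y _
      exact ((Equiv.subRight y).hasSum_iff.mpr ih).mul_left _
    have h2 := hasSum_sum h1
    rw [← Finset.sum_mul, ← pow_succ'] at h2
    convert h2 using 2 with x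
    have : convZPow μ (n+1) x = ∑ y ∈ S, μ y * convZPow μ n (x - y) := by
      show ∑' y : ℤ, _ = _
      exact tsum_eq_sum fun y hy => by rw [hS y hy, zero_mul]
    rw [this, Finset.sum_mul]
    refine Finset.sum_congr rfl fun y _ => ?_
    have : Real.exp (t * x) = Real.exp (t * y) * Real.exp (t * ((x - y : ℤ) : ℝ)) := by
      rw [← Real.exp_add]; congr 1; push_cast; ring
    rw [this]; ring

lemma mgf_cosh (μ : ℤ → ℝ) (S : Finset ℤ) (hS : ∀ x, x ∉ S → μ x = 0)
    (hsym : ∀ x : ℤ, μ x = μ (-x)) (t : ℝ) :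
    ∑ y ∈ S, μ y * Real.exp (t * y) = ∑ y ∈ S, μ y * Real.cosh (t * y) := by
  have h : ∀ f : ℤ → ℝ, ∑ y ∈ S, μ y * f y = ∑' y, μ y * f y := fun f =>
    (tsum_eq_sum fun y hy => by rw [hS y hy, zero_mul]).symm
  have h1 : ∑ y ∈ S, μ y * Real.exp (t * y) = ∑ y ∈ S, μ y * Real.exp (-(t * y)) := by
    rw [h (fun y => Real.exp (t * y)), h (fun y => Real.exp (-(t * y))),
      ← (Equiv.neg ℤ).tsum_eq]
    refine tsum_congr fun y => ?_
    simp [← hsym y]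
  have h2 : ∑ y ∈ S, μ y * Real.cosh (t * y) =
      (∑ y ∈ S, μ y * Real.exp (t * y) + ∑ y ∈ S, μ y * Real.exp (-(t * y))) / 2 := by
    rw [← Finset.sum_add_distrib, Finset.sum_div]
    refine Finset.sum_congr rfl fun y _ => ?_
    rw [Real.cosh_eq]; ring
  rw [h2, ← h1]; ring

lemma cosh_lower (u : ℝ) : 1 + u ^ 2 / 2 ≤ Real.cosh u := by
  have h := Real.cosh_two_mul (u/2)
  have h2 := Real.cosh_sq (u/2)
  have h3 : (u/2)^2 ≤ Real.sinh (u/2) ^ 2 := by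
    rw [sq_le_sq, Real.abs_sinh]
    exact Real.self_le_sinh_iff.mpr (abs_nonneg _)
  rw [show 2 * (u/2) = u by ring] at h
  nlinarith

lemma exp_half_le (s : ℝ) (h0 : 0 ≤ s) (h1 : s ≤ 1) : Real.exp (s / 2) ≤ 1 + s := by
  have h := Real.add_one_le_exp (-(s/2))
  have h3 : Real.exp (s/2) * Real.exp (-(s/2)) = 1 := by rw [← Real.exp_add]; simp
  have h4 := Real.exp_pos (s/2)
  nlinarith

set_option maxHeartbeats 2000000 in
/-- For a symmetric finitely supported random walk on `ℤ` whose step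
distribution has a nonzero element in its support, there are `C₁, C₂ > 0` such that for all
large `n` and all real `L` with `√n ≤ L ≤ n^{2/3}`:
`μ^{*n}({x ≥ L}) ≥ C₁ (√n / L) exp(-C₂ L² / n)`. -/
theorem stmt16 (μ : ℤ → ℝ) (hμ0 : ∀ x, 0 ≤ μ x) (hμ1 : HasSum μ 1)
    (hsym : ∀ x : ℤ, μ x = μ (-x))
    (hfin : (Function.support μ).Finite)
    (hnz : ∃ x : ℤ, x ≠ 0 ∧ μ x ≠ 0) :
    ∃ C₁ > (0 : ℝ), ∃ C₂ > (0 : ℝ), ∃ N : ℕ, ∀ n ≥ N, ∀ L : ℝ,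
      Real.sqrt n ≤ L → L ≤ (n : ℝ) ^ ((2 : ℝ) / 3) →
      C₁ * (Real.sqrt n / L) * Real.exp (-C₂ * L ^ 2 / n) ≤
        ∑' x : {x : ℤ | L ≤ (x : ℝ)}, convZPow μ n x := by
  obtain ⟨S, hSdef⟩ : ∃ S : Finset ℤ, S = hfin.toFinset := ⟨_, rfl⟩
  have hS : ∀ x, x ∉ S → μ x = 0 := by
    intro x hx
    simpa [hSdef] using hx
  have hsum1 : ∑ y ∈ S, μ y = 1 := (hasSum_sum_of_ne_finset_zero (fun b hb => hS b hb)).unique hμ1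
  set φ : ℝ → ℝ := fun t => ∑ y ∈ S, μ y * Real.exp (t * y) with hφ
  have hφc : ∀ t, φ t = ∑ y ∈ S, μ y * Real.cosh (t * y) := mgf_cosh μ S hS hsym
  obtain ⟨c, hc⟩ : ∃ c : ℝ, c = (∑ y ∈ S, μ y * (y : ℝ) ^ 2) / 4 := ⟨_, rfl⟩
  have hcpos : 0 < c := by
    rw [hc]
    obtain ⟨x, hx0, hx⟩ := hnz
    refine div_pos (Finset.sum_pos' (fun y _ => mul_nonneg (hμ0 y) (sq_nonneg _))
      ⟨x, by by_contra h; exact hx (hS x h), ?_⟩) (by norm_num)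
    have : (x : ℝ) ≠ 0 := by exact_mod_cast hx0
    have := (hμ0 x).lt_of_ne' hx
    positivity
  obtain ⟨R, hR0, hR⟩ : ∃ R : ℝ, 0 < R ∧ ∀ y ∈ S, (y : ℝ) ^ 2 ≤ R := by
    refine ⟨1 + ∑ y ∈ S, (y : ℝ) ^ 2, ?_, fun y hy => ?_⟩
    · have : 0 ≤ ∑ y ∈ S, (y : ℝ) ^ 2 := Finset.sum_nonneg fun _ _ => sq_nonneg _
      linarith
    · have := Finset.single_le_sum (f := fun y : ℤ => (y : ℝ) ^ 2) (fun _ _ => sq_nonneg _) hy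
      linarith
  have hlow : ∀ t, 1 + 2 * c * t ^ 2 ≤ φ t := by
    intro t
    have : 1 + 2 * c * t ^ 2 = ∑ y ∈ S, μ y * (1 + (t * y) ^ 2 / 2) := by
      have : ∀ y ∈ S, μ y * (1 + (t * y) ^ 2 / 2) = μ y + (μ y * (y : ℝ) ^ 2) * (t ^ 2 / 2) := by
        intro y _; ring
      rw [Finset.sum_congr rfl this, Finset.sum_add_distrib, ← Finset.sum_mul, hsum1, hc]; ring
    rw [this, hφc]
    exact Finset.sum_le_sum fun y _ => mul_le_mul_of_nonneg_left (cosh_lower _) (hμ0 y)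
  have hup : ∀ t, φ t ≤ Real.exp (R * t ^ 2 / 2) := by
    intro t
    rw [hφc]
    calc _ ≤ ∑ y ∈ S, μ y * Real.exp (R * t ^ 2 / 2) := by
          refine Finset.sum_le_sum fun y hy => mul_le_mul_of_nonneg_left ?_ (hμ0 y)
          refine (Real.cosh_le_exp_half_sq _).trans (Real.exp_le_exp.mpr ?_)
          have := mul_le_mul_of_nonneg_right (hR y hy) (sq_nonneg t)
          rw [mul_pow]; linarith
      _ = _ := by rw [← Finset.sum_mul, hsum1, one_mul]
  obtain ⟨A, hA⟩ : ∃ A : ℝ, A = 1 + 1 / c := ⟨_, rfl⟩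
  have hAc : A * c = c + 1 := by rw [hA]; field_simp
  have hA1 : 1 ≤ A := by rw [hA]; have : 0 < 1 / c := by positivity
                         linarith
  refine ⟨1 / 4, by norm_num, 2 * R * A ^ 2, by positivity, ⌈(2 * c * A ^ 2) ^ 2⌉₊ + 1, ?_⟩
  intro n hn L hL1 hL2
  have hn0 : (0 : ℝ) < n := by
    have : 0 < n := by omega
    exact_mod_cast this
  have hsq : 0 < Real.sqrt n := Real.sqrt_pos.mpr hn0
  have hL0 : 0 < L := hsq.trans_le hL1
  have hnL : (n : ℝ) ≤ L ^ 2 := by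
    have := Real.sq_sqrt hn0.le
    nlinarith
  have hL3 : L ^ 3 ≤ (n : ℝ) ^ 2 := by
    calc L ^ 3 ≤ ((n : ℝ) ^ ((2 : ℝ) / 3)) ^ 3 := by gcongr
      _ = (n : ℝ) ^ 2 := by
        rw [← Real.rpow_natCast, ← Real.rpow_mul hn0.le, ← Real.rpow_natCast]; norm_num
  have hLbig : 2 * c * A ^ 2 ≤ L := by
    refine le_trans ?_ hL1
    refine Real.le_sqrt_of_sq_le ?_
    have h1 := Nat.le_ceil ((2 * c * A ^ 2) ^ 2)
    have h2 : ((⌈(2 * c * A ^ 2) ^ 2⌉₊ : ℕ) : ℝ) ≤ n := by exact_mod_cast (by omega)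
    linarith
  obtain ⟨t, ht⟩ : ∃ t : ℝ, t = A * L / n := ⟨_, rfl⟩
  have ht0 : 0 < t := by rw [ht]; positivity
  have hts : 2 * c * t ^ 2 ≤ 1 := by
    rw [ht, div_pow, ← mul_div_assoc, div_le_one (by positivity)]
    calc 2 * c * (A * L) ^ 2 = (2 * c * A ^ 2) * L ^ 2 := by ring
      _ ≤ L * L ^ 2 := by gcongr
      _ ≤ _ := by linarith
  have hφt : Real.exp (c * t ^ 2) ≤ φ t := by
    refine le_trans ?_ (hlow t)
    have := exp_half_le (2 * c * t ^ 2) (by positivity) hts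
    rwa [show 2 * c * t ^ 2 / 2 = c * t ^ 2 by ring] at this
  obtain ⟨m, hm⟩ : ∃ m, m = φ t ^ n := ⟨_, rfl⟩
  obtain ⟨m2, hm2⟩ : ∃ m2, m2 = φ (2 * t) ^ n := ⟨_, rfl⟩
  have hmexp : Real.exp (n * (c * t ^ 2)) ≤ m := by
    rw [hm, Real.exp_nat_mul]; gcongr
  have hm1 : 1 ≤ m := le_trans (Real.one_le_exp (by positivity)) hmexp
  have hm2p : 0 < m2 := by
    rw [hm2]
    have : 0 < φ (2 * t) := lt_of_lt_of_le (by positivity) (hlow (2 * t))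
    positivity
  have hm2u : m2 ≤ Real.exp (2 * R * A ^ 2 * L ^ 2 / n) := by
    have : 2 * R * A ^ 2 * L ^ 2 / n = n * (R * (2 * t) ^ 2 / 2) := by
      rw [ht]; field_simp
    rw [this, Real.exp_nat_mul, hm2]
    have : 0 ≤ φ (2 * t) := le_trans (by positivity) (hlow (2 * t))
    have := hup (2 * t)
    gcongr
  have hkey : ∀ x : ℤ, (x : ℝ) < L → Real.exp (t * x) ≤ m / 2 := by
    intro x hx
    have h1 : t * x ≤ n * (c * t ^ 2) - 1 := by
      have h2 : t * x ≤ t * L := by gcongr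
      have h3 : t * L = A * (L ^ 2 / n) := by rw [ht]; ring
      have h4 : n * (c * t ^ 2) = (A * c) * A * (L ^ 2 / n) := by rw [ht]; field_simp
      have h5 : 1 ≤ L ^ 2 / n := by rwa [one_le_div hn0]
      have h6 : 1 ≤ c * A := by linarith
      rw [hAc] at h4
      have h7 : 1 ≤ c * A * (L ^ 2 / n) := one_le_mul_of_one_le_of_one_le h6 h5
      nlinarith
    have h2 : Real.exp (t * x) ≤ Real.exp (n * (c * t ^ 2)) * Real.exp (-1) := by
      rw [← Real.exp_add]; exact Real.exp_le_exp.mpr (by linarith)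
    have h3 : Real.exp (-1) ≤ 1 / 2 := by
      rw [Real.exp_neg, one_div]
      have := Real.add_one_le_exp (1 : ℝ)
      exact inv_anti₀ (by norm_num) (by linarith)
    calc _ ≤ _ := h2
      _ ≤ m * (1 / 2) := by gcongr
      _ = _ := by ring
  have hp := convZPow_nonneg' μ hμ0 n
  have H0 : HasSum (fun x : ℤ => convZPow μ n x) 1 := by
    have := hasSum_mgf μ S hS 0 n
    simpa [hsum1] using this
  have H1 : HasSum (fun x : ℤ => convZPow μ n x * Real.exp (t * x)) m := by
    rw [hm]; exact hasSum_mgf μ S hS t n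
  have H2 : HasSum (fun x : ℤ => convZPow μ n x * Real.exp (2 * t * x)) m2 := by
    rw [hm2]; exact hasSum_mgf μ S hS (2 * t) n
  have HA := (H0.summable.indicator {x : ℤ | L ≤ (x : ℝ)}).hasSum
  rw [← tsum_subtype] at HA
  obtain ⟨l, hl⟩ : ∃ l, l = m / (2 * m2) := ⟨_, rfl⟩
  have hl0 : 0 < l := by rw [hl]; positivity
  have HB := ((H1.mul_left (2 * l)).sub (H0.mul_left (l * m))).sub (H2.mul_left (l ^ 2))
  have hle := hasSum_le (fun x => ?_) HB HA
  swap
  · have e2 : Real.exp (2 * t * x) = Real.exp (t * x) ^ 2 := by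
      rw [← Real.exp_nat_mul]; congr 1; push_cast; ring
    rw [e2]
    have hlm : 0 < l * m := by positivity
    by_cases hx : L ≤ (x : ℝ)
    · rw [Set.indicator_of_mem (by exact hx)]
      nlinarith [mul_nonneg (hp x) (sq_nonneg (l * Real.exp (t * x) - 1)), mul_nonneg (hp x) hlm.le]
    · rw [Set.indicator_of_notMem (by exact hx)]
      have := hkey x (not_le.mp hx)
      have h3 : 0 ≤ l * (m / 2 - Real.exp (t * x)) := mul_nonneg hl0.le (by linarith)
      nlinarith [mul_nonneg (hp x) h3, mul_nonneg (hp x) (sq_nonneg (l * Real.exp (t * x)))]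
  refine le_trans ?_ hle
  have e : 2 * l * m - l * m * 1 - l ^ 2 * m2 = m ^ 2 / (4 * m2) := by
    rw [hl]; field_simp; ring
  rw [e]
  have hr : Real.sqrt n / L ≤ 1 := by rwa [div_le_one hL0]
  have hneg : Real.exp (-(2 * R * A ^ 2) * L ^ 2 / n) ≤ 1 / m2 := by
    rw [show -(2 * R * A ^ 2) * L ^ 2 / n = -(2 * R * A ^ 2 * L ^ 2 / n) by ring, Real.exp_neg,
      one_div]
    exact inv_anti₀ hm2p hm2u
  calc _ ≤ 1 / 4 * 1 * (1 / m2) := by gcongr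
    _ = 1 / (4 * m2) := by field_simp
    _ ≤ _ := by
      gcongr
      nlinarith
end
end
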